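/- arXiv:1504.06928 — 7 statements merged into one kernel-verified Lean document; each statement's English description precedes it below -/
import Mathlib

section
/- Let p, s, m, l, M, N be positive integers with p < s, m < l, l + p = m + s, and let c₁, c₂ be nonzero real numbers. If Equation (Prod) holds at every natural number k ≥ 0, then m = p, l = s, and c₁ = c₂. -/
open Finset

/-- `R₁(k) = (k+s+1)/(k+(N+1)s+1)`. -/
noncomputable def R1 (s N k : ℕ) : ℝ := (k + s + 1) / (k + (N + 1) * s + 1)

/-- `P₁(k) = ∏_{j=1}^{M} (k+s+jp+1)/(k+s+m+jp+1)`. -/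
noncomputable def P1 (p s m M k : ℕ) : ℝ :=
  ∏ j ∈ Finset.Icc 1 M, ((k + s + j * p + 1 : ℝ) / (k + s + m + j * p + 1))

/-- `R₂(k) = (k+m+s+1)/(k+m+(N+1)s+1)`. -/
noncomputable def R2 (s m N k : ℕ) : ℝ := (k + m + s + 1) / (k + m + (N + 1) * s + 1)

/-- `P₂(k) = ∏_{j=1}^{M} (k+jp+1)/(k+m+jp+1)`. -/
noncomputable def P2 (p m M k : ℕ) : ℝ :=
  ∏ j ∈ Finset.Icc 1 M, ((k + j * p + 1 : ℝ) / (k + m + j * p + 1))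

/-- `R₃(k) = (k+l+p+1)/(k+l+(M+1)p+1)`. -/
noncomputable def R3 (p l M k : ℕ) : ℝ := (k + l + p + 1) / (k + l + (M + 1) * p + 1)

/-- `P₃(k) = ∏_{j=1}^{N} (k+js+1)/(k+l+js+1)`. -/
noncomputable def P3 (s l N k : ℕ) : ℝ :=
  ∏ j ∈ Finset.Icc 1 N, ((k + j * s + 1 : ℝ) / (k + l + j * s + 1))

/-- `R₄(k) = (k+p+1)/(k+(M+1)p+1)`. -/
noncomputable def R4 (p M k : ℕ) : ℝ := (k + p + 1) / (k + (M + 1) * p + 1)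

/-- `P₄(k) = ∏_{j=1}^{N} (k+p+js+1)/(k+l+p+js+1)`. -/
noncomputable def P4 (p s l N k : ℕ) : ℝ :=
  ∏ j ∈ Finset.Icc 1 N, ((k + p + j * s + 1 : ℝ) / (k + l + p + j * s + 1))

/-- Equation (Prod) holds at `k`:
`c₁ (R₁P₁ - R₂P₂) = c₂ (R₃P₃ - R₄P₄)`. -/
def ProdEq (p s m l M N : ℕ) (c1 c2 : ℝ) (k : ℕ) : Prop :=
  c1 * (R1 s N k * P1 p s m M k - R2 s m N k * P2 p m M k) =
    c2 * (R3 p l M k * P3 s l N k - R4 p M k * P4 p s l N k)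

/-- `F` has constant coefficient one and logarithmic power sums `q`. -/
def HasLog (F : PowerSeries ℝ) (q : ℕ → ℝ) : Prop :=
  PowerSeries.constantCoeff F = 1 ∧
    PowerSeries.derivative ℝ F = F * PowerSeries.mk (fun n => (-1) ^ n * q (n + 1))

theorem hasLog_linear (a : ℝ) :
    HasLog (1 + PowerSeries.C a * PowerSeries.X) (fun n => a ^ n) := by
  refine ⟨by simp, ?_⟩
  ext n
  rw [PowerSeries.coeff_derivative, add_mul, one_mul, map_add, map_add, mul_assoc,
    PowerSeries.coeff_C_mul, PowerSeries.coeff_C_mul]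
  cases n with
  | zero => simp
  | succ n =>
    rw [PowerSeries.coeff_succ_X_mul, PowerSeries.coeff_mk, PowerSeries.coeff_mk,
      PowerSeries.coeff_X, PowerSeries.coeff_one]
    simp only [Nat.add_eq_zero_iff, one_ne_zero, and_false, if_false, Nat.add_eq_right]
    norm_num
    ring

theorem HasLog.mul {F G : PowerSeries ℝ} {q r : ℕ → ℝ} (hF : HasLog F q) (hG : HasLog G r) :
    HasLog (F * G) (fun n => q n + r n) := by
  refine ⟨by simp [hF.1, hG.1], ?_⟩
  have : PowerSeries.mk (fun n => (-1) ^ n * (q (n + 1) + r (n + 1))) =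
      PowerSeries.mk (fun n => (-1) ^ n * q (n + 1)) +
      PowerSeries.mk (fun n => (-1 : ℝ) ^ n * r (n + 1)) := by
    ext n; simp [mul_add]
  rw [this, Derivation.leibniz, hF.2, hG.2, smul_eq_mul, smul_eq_mul]
  ring

theorem hasLog_prod (a : ℕ → ℝ) (s : Finset ℕ) :
    HasLog (∏ j ∈ s, (1 + PowerSeries.C (a j) * PowerSeries.X)) (fun n => ∑ j ∈ s, a j ^ n) := by
  induction s using Finset.induction_on with
  | empty =>
    refine ⟨by simp, ?_⟩
    ext n; simp
  | insert i s hi ih =>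
    simp only [Finset.prod_insert hi, Finset.sum_insert hi]
    exact (hasLog_linear _).mul ih

theorem HasLog.div {F A B : PowerSeries ℝ} {q r : ℕ → ℝ} (hA : HasLog A q) (hB : HasLog B r)
    (h : F * B = A) : HasLog F (fun n => q n - r n) := by
  have hB0 : B ≠ 0 := by
    intro h0
    have := hB.1
    simp [h0] at this
  refine ⟨?_, ?_⟩
  · have := congrArg PowerSeries.constantCoeff h
    simpa [hA.1, hB.1] using this
  · have e : PowerSeries.mk (fun n => (-1) ^ n * (q (n + 1) - r (n + 1))) =
      PowerSeries.mk (fun n => (-1) ^ n * q (n + 1)) -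
      PowerSeries.mk (fun n => (-1 : ℝ) ^ n * r (n + 1)) := by
      ext n; simp [mul_sub]
    have hd := hA.2
    rw [← h, Derivation.leibniz, hB.2, smul_eq_mul, smul_eq_mul] at hd
    apply mul_right_cancel₀ hB0
    rw [e]
    linear_combination hd

theorem HasLog.coeffs {F : PowerSeries ℝ} {q : ℕ → ℝ} (h : HasLog F q) :
    F.coeff 1 = q 1 ∧
    2 * F.coeff 2 = F.coeff 1 * q 1 - q 2 ∧
    3 * F.coeff 3 = F.coeff 2 * q 1 - F.coeff 1 * q 2 + q 3 ∧
    4 * F.coeff 4 = F.coeff 3 * q 1 - F.coeff 2 * q 2 + F.coeff 1 * q 3 - q 4 ∧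
    5 * F.coeff 5 = F.coeff 4 * q 1 - F.coeff 3 * q 2 + F.coeff 2 * q 3
      - F.coeff 1 * q 4 + q 5 := by
  have key : ∀ n, F.coeff (n + 1) * (n + 1) = ∑ k ∈ Finset.range (n + 1),
      F.coeff k * ((-1) ^ (n - k) * q (n - k + 1)) := by
    intro n
    have := congrArg (PowerSeries.coeff n) h.2
    rw [PowerSeries.coeff_derivative, PowerSeries.coeff_mul,
      Finset.Nat.sum_antidiagonal_eq_sum_range_succ_mk] at this
    simpa using this
  have h0 : F.coeff 0 = 1 := by simpa using h.1
  have k0 := key 0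
  have k1 := key 1
  have k2 := key 2
  have k3 := key 3
  have k4 := key 4
  simp only [Finset.sum_range_succ, Finset.sum_range_zero, h0] at k0 k1 k2 k3 k4
  norm_num at k0 k1 k2 k3 k4
  refine ⟨?_, ?_, ?_, ?_, ?_⟩ <;> linarith

/-- Numerator or denominator polynomial. -/
noncomputable def linPoly (a0 : ℝ) (a : ℕ → ℝ) (M : ℕ) : Polynomial ℝ :=
  (1 + Polynomial.C a0 * Polynomial.X) *
    ∏ j ∈ Finset.Icc 1 M, (1 + Polynomial.C (a j) * Polynomial.X)

theorem linPoly_hasLog (a0 : ℝ) (a : ℕ → ℝ) (M : ℕ) :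
    HasLog (linPoly a0 a M : PowerSeries ℝ)
      (fun n => a0 ^ n + ∑ j ∈ Finset.Icc 1 M, a j ^ n) := by
  have := (hasLog_linear a0).mul (hasLog_prod a (Finset.Icc 1 M))
  convert this using 1
  rw [linPoly, Polynomial.coe_mul]
  congr 1
  · simp
  · rw [← Polynomial.coeToPowerSeries.ringHom_apply, map_prod]
    simp

theorem linPoly_eval (a0 : ℝ) (a : ℕ → ℝ) (M : ℕ) (x : ℝ) (hx : 0 < x) :
    (linPoly a0 a M).eval (1 / x) * x ^ (M + 1) =
      (x + a0) * ∏ j ∈ Finset.Icc 1 M, (x + a j) := by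
  have h : ∀ b : ℝ, (1 + b * (1 / x)) * x = x + b := by
    intro b; field_simp
  have h2 : (∏ j ∈ Finset.Icc 1 M, (1 + a j * (1 / x))) * x ^ M =
      ∏ j ∈ Finset.Icc 1 M, (x + a j) := by
    have : x ^ M = ∏ j ∈ Finset.Icc 1 M, x := by simp
    rw [this, ← Finset.prod_mul_distrib]
    exact Finset.prod_congr rfl fun j _ => h _
  rw [linPoly, Polynomial.eval_mul, Polynomial.eval_prod, ← h a0, ← h2]
  simp only [Polynomial.eval_add, Polynomial.eval_one, Polynomial.eval_mul, Polynomial.eval_C,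
    Polynomial.eval_X]
  ring

theorem linPoly_eval_pos (a0 : ℝ) (a : ℕ → ℝ) (M : ℕ) (x : ℝ) (hx : 0 < x) (h0 : 0 ≤ a0)
    (ha : ∀ j, 0 ≤ a j) : 0 < (linPoly a0 a M).eval (1 / x) := by
  have h := linPoly_eval a0 a M x hx
  have : 0 < (x + a0) * ∏ j ∈ Finset.Icc 1 M, (x + a j) :=
    mul_pos (by linarith) (Finset.prod_pos fun j _ => by linarith [ha j])
  rw [← h] at this
  exact pos_of_mul_pos_left this (by positivity)

theorem ratio_eval (a0 b0 : ℝ) (a b : ℕ → ℝ) (M : ℕ) (x : ℝ) (hx : 0 < x) :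
    (x + a0) / (x + b0) * ∏ j ∈ Finset.Icc 1 M, ((x + a j) / (x + b j)) =
      (linPoly a0 a M).eval (1 / x) / (linPoly b0 b M).eval (1 / x) := by
  rw [Finset.prod_div_distrib, div_mul_div_comm, ← linPoly_eval _ _ _ _ hx,
    ← linPoly_eval _ _ _ _ hx, mul_div_mul_right]
  positivity

theorem linPoly_ne (a0 : ℝ) (a : ℕ → ℝ) (M : ℕ) :
    PowerSeries.constantCoeff (linPoly a0 a M : PowerSeries ℝ) ≠ 0 := by
  rw [(linPoly_hasLog a0 a M).1]; exact one_ne_zero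

/-- The power series of a ratio. -/
noncomputable def ratSer (a0 b0 : ℝ) (a b : ℕ → ℝ) (M : ℕ) : PowerSeries ℝ :=
  (linPoly a0 a M : PowerSeries ℝ) * (linPoly b0 b M : PowerSeries ℝ)⁻¹

theorem ratSer_mul (a0 b0 : ℝ) (a b : ℕ → ℝ) (M : ℕ) :
    ratSer a0 b0 a b M * (linPoly b0 b M : PowerSeries ℝ) = (linPoly a0 a M : PowerSeries ℝ) := by
  rw [ratSer, mul_assoc, PowerSeries.inv_mul_cancel _ (linPoly_ne _ _ _), mul_one]

theorem ratSer_hasLog (a0 b0 : ℝ) (a b : ℕ → ℝ) (M : ℕ) :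
    HasLog (ratSer a0 b0 a b M)
      (fun n => a0 ^ n - b0 ^ n + ∑ j ∈ Finset.Icc 1 M, (a j ^ n - b j ^ n)) := by
  have := (linPoly_hasLog a0 a M).div (linPoly_hasLog b0 b M) (ratSer_mul a0 b0 a b M)
  convert this using 2
  rw [Finset.sum_sub_distrib]; ring

/-- Transfer of the identity from the sample points to power series. -/
theorem transfer (A1 B1 A2 B2 A3 B3 A4 B4 : Polynomial ℝ) (f1 f2 f3 f4 : PowerSeries ℝ)
    (h1 : f1 * B1 = A1) (h2 : f2 * B2 = A2) (h3 : f3 * B3 = A3) (h4 : f4 * B4 = A4)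
    (n1 : ∀ k : ℕ, B1.eval (1 / ((k : ℝ) + 1)) ≠ 0) (n2 : ∀ k : ℕ, B2.eval (1 / ((k : ℝ) + 1)) ≠ 0)
    (n3 : ∀ k : ℕ, B3.eval (1 / ((k : ℝ) + 1)) ≠ 0) (n4 : ∀ k : ℕ, B4.eval (1 / ((k : ℝ) + 1)) ≠ 0)
    (c1 c2 : ℝ)
    (h : ∀ k : ℕ,
      c1 * (A1.eval (1 / ((k : ℝ) + 1)) / B1.eval (1 / ((k : ℝ) + 1))
        - A2.eval (1 / ((k : ℝ) + 1)) / B2.eval (1 / ((k : ℝ) + 1))) =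
      c2 * (A3.eval (1 / ((k : ℝ) + 1)) / B3.eval (1 / ((k : ℝ) + 1))
        - A4.eval (1 / ((k : ℝ) + 1)) / B4.eval (1 / ((k : ℝ) + 1)))) (n : ℕ) :
    c1 * (f1.coeff n - f2.coeff n) = c2 * (f3.coeff n - f4.coeff n) := by
  have hpoly : Polynomial.C c1 * (A1 * B2 - A2 * B1) * (B3 * B4) =
      Polynomial.C c2 * (A3 * B4 - A4 * B3) * (B1 * B2) := by
    apply Polynomial.eq_of_infinite_eval_eq
    apply Set.Infinite.mono (s := Set.range fun k : ℕ => 1 / ((k : ℝ) + 1))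
    · rintro _ ⟨k, rfl⟩
      have hk := h k
      have := n1 k
      have := n2 k
      have := n3 k
      have := n4 k
      simp only [Set.mem_ofPred_eq, Polynomial.eval_mul, Polynomial.eval_sub, Polynomial.eval_C]
      field_simp at hk
      linear_combination hk
    · apply Set.infinite_range_of_injective
      intro a b hab
      have : ((a : ℝ) + 1) = b + 1 := by simpa using hab
      exact_mod_cast add_right_cancel this
  have hps := congrArg (fun P : Polynomial ℝ => (P : PowerSeries ℝ)) hpoly
  simp only [Polynomial.coe_mul, Polynomial.coe_sub, Polynomial.coe_C, ← h1, ← h2, ← h3, ← h4]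
    at hps
  have ne : ∀ B : Polynomial ℝ, (∀ k : ℕ, B.eval (1 / ((k : ℝ) + 1)) ≠ 0) →
      (B : PowerSeries ℝ) ≠ 0 := by
    intro B hB h0
    have : B = 0 := by exact_mod_cast h0
    exact hB 0 (by simp [this])
  have hfin : PowerSeries.C c1 * (f1 - f2) = PowerSeries.C c2 * (f3 - f4) := by
    have hne : (B1 : PowerSeries ℝ) * B2 * B3 * B4 ≠ 0 :=
      mul_ne_zero (mul_ne_zero (mul_ne_zero (ne _ n1) (ne _ n2)) (ne _ n3)) (ne _ n4)
    apply mul_right_cancel₀ hne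
    linear_combination hps
  have := congrArg (PowerSeries.coeff n) hfin
  simpa using this

theorem sum1 (a b p : ℝ) (M : ℕ) : ∑ j ∈ Finset.Icc 1 M, ((a + j * p) ^ 1 - (b + j * p) ^ 1) =
    M * (a - b) := by
  induction M with
  | zero => simp
  | succ n ih => rw [Finset.sum_Icc_succ_top (by omega), ih]; push_cast; ring

theorem sum2 (a b p : ℝ) (M : ℕ) : ∑ j ∈ Finset.Icc 1 M, ((a + j * p) ^ 2 - (b + j * p) ^ 2) =
    M * (a ^ 2 - b ^ 2) + (a - b) * p * (M * (M + 1)) := by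
  induction M with
  | zero => simp
  | succ n ih => rw [Finset.sum_Icc_succ_top (by omega), ih]; push_cast; ring

theorem sum3 (a b p : ℝ) (M : ℕ) : ∑ j ∈ Finset.Icc 1 M, ((a + j * p) ^ 3 - (b + j * p) ^ 3) =
    M * (a ^ 3 - b ^ 3) + 3 * (a ^ 2 - b ^ 2) * p * (M * (M + 1) / 2)
      + 3 * (a - b) * p ^ 2 * (M * (M + 1) * (2 * M + 1) / 6) := by
  induction M with
  | zero => simp
  | succ n ih => rw [Finset.sum_Icc_succ_top (by omega), ih]; push_cast; ring

theorem sum4 (a b p : ℝ) (M : ℕ) : ∑ j ∈ Finset.Icc 1 M, ((a + j * p) ^ 4 - (b + j * p) ^ 4) =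
    M * (a ^ 4 - b ^ 4) + 4 * (a ^ 3 - b ^ 3) * p * (M * (M + 1) / 2)
      + 6 * (a ^ 2 - b ^ 2) * p ^ 2 * (M * (M + 1) * (2 * M + 1) / 6)
      + 4 * (a - b) * p ^ 3 * (M * (M + 1) / 2) ^ 2 := by
  induction M with
  | zero => simp
  | succ n ih => rw [Finset.sum_Icc_succ_top (by omega), ih]; push_cast; ring

theorem sum5 (a b p : ℝ) (M : ℕ) : ∑ j ∈ Finset.Icc 1 M, ((a + j * p) ^ 5 - (b + j * p) ^ 5) =
    M * (a ^ 5 - b ^ 5) + 5 * (a ^ 4 - b ^ 4) * p * (M * (M + 1) / 2)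
      + 10 * (a ^ 3 - b ^ 3) * p ^ 2 * (M * (M + 1) * (2 * M + 1) / 6)
      + 10 * (a ^ 2 - b ^ 2) * p ^ 3 * (M * (M + 1) / 2) ^ 2
      + 5 * (a - b) * p ^ 4 * (M * (M + 1) * (2 * M + 1) * (3 * M ^ 2 + 3 * M - 1) / 30) := by
  induction M with
  | zero => simp
  | succ n ih => rw [Finset.sum_Icc_succ_top (by omega), ih]; push_cast; ring

/-- Coefficient recursion for the ratio with arithmetic progressions. -/
theorem ratSer_coeffs (a0 b0 a b p : ℝ) (M : ℕ) (F : PowerSeries ℝ)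
    (hF : F = ratSer a0 b0 (fun j => a + j * p) (fun j => b + j * p) M) :
    ∃ q1 q2 q3 q4 q5 : ℝ,
    (q1 = a0 - b0 + M * (a - b)) ∧
    (q2 = a0 ^ 2 - b0 ^ 2 + (M * (a ^ 2 - b ^ 2) + (a - b) * p * (M * (M + 1)))) ∧
    (q3 = a0 ^ 3 - b0 ^ 3 + (M * (a ^ 3 - b ^ 3) + 3 * (a ^ 2 - b ^ 2) * p * (M * (M + 1) / 2)
      + 3 * (a - b) * p ^ 2 * (M * (M + 1) * (2 * M + 1) / 6))) ∧
    (q4 = a0 ^ 4 - b0 ^ 4 + (M * (a ^ 4 - b ^ 4) + 4 * (a ^ 3 - b ^ 3) * p * (M * (M + 1) / 2)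
      + 6 * (a ^ 2 - b ^ 2) * p ^ 2 * (M * (M + 1) * (2 * M + 1) / 6)
      + 4 * (a - b) * p ^ 3 * (M * (M + 1) / 2) ^ 2)) ∧
    (q5 = a0 ^ 5 - b0 ^ 5 + (M * (a ^ 5 - b ^ 5) + 5 * (a ^ 4 - b ^ 4) * p * (M * (M + 1) / 2)
      + 10 * (a ^ 3 - b ^ 3) * p ^ 2 * (M * (M + 1) * (2 * M + 1) / 6)
      + 10 * (a ^ 2 - b ^ 2) * p ^ 3 * (M * (M + 1) / 2) ^ 2
      + 5 * (a - b) * p ^ 4 * (M * (M + 1) * (2 * M + 1) * (3 * M ^ 2 + 3 * M - 1) / 30))) ∧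
    F.coeff 2 = (q1 ^ 2 - q2) / 2 ∧
    F.coeff 3 = (q1 ^ 3 - 3 * q1 * q2 + 2 * q3) / 6 ∧
    F.coeff 5 = q1 ^ 5 / 120 - q1 ^ 3 * q2 / 12 + q1 * q2 ^ 2 / 8 + q1 ^ 2 * q3 / 6 - q2 * q3 / 6
      - q1 * q4 / 4 + q5 / 5 := by
  obtain ⟨e1, e2, e3, e4, e5⟩ :=
    (ratSer_hasLog a0 b0 (fun j => a + j * p) (fun j => b + j * p) M).coeffs
  rw [← hF] at e1 e2 e3 e4 e5
  simp only [sum1, sum2, sum3, sum4, sum5] at e1 e2 e3 e4 e5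
  refine ⟨_, _, _, _, _, rfl, rfl, rfl, rfl, rfl, ?_⟩
  simp only [pow_one] at e1 e2 e3 e4 e5
  generalize a0 - b0 + M * (a - b) = q1 at *
  generalize a0 ^ 2 - b0 ^ 2 + _ = q2 at *
  generalize a0 ^ 3 - b0 ^ 3 + _ = q3 at *
  generalize a0 ^ 4 - b0 ^ 4 + _ = q4 at *
  generalize a0 ^ 5 - b0 ^ 5 + _ = q5 at *
  have f2 : F.coeff 2 = (q1 ^ 2 - q2) / 2 := by rw [e1] at e2; linarith
  have f3 : F.coeff 3 = (q1 ^ 3 - 3 * q1 * q2 + 2 * q3) / 6 := by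
    rw [e1, f2] at e3; linarith
  have f4 : F.coeff 4 = (F.coeff 3 * q1 - F.coeff 2 * q2 + F.coeff 1 * q3 - q4) / 4 := by
    linarith
  refine ⟨f2, f3, ?_⟩
  rw [f4, f3, f2, e1] at e5
  linarith

/-- if Equation (Prod) holds at every `k`, then `m = p`, `l = s`
and `c₁ = c₂`. -/
theorem prodEq_forall_implies (p s m l M N : ℕ)
    (hp : 0 < p) (hs : 0 < s) (hm : 0 < m) (hl : 0 < l) (hM : 0 < M) (hN : 0 < N)
    (hps : p < s) (hml : m < l) (hsum : l + p = m + s)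
    (c1 c2 : ℝ) (hc1 : c1 ≠ 0) (hc2 : c2 ≠ 0)
    (hProd : ∀ k : ℕ, ProdEq p s m l M N c1 c2 k) :
    m = p ∧ l = s ∧ c1 = c2 := by
  have key := transfer
    (linPoly (s : ℝ) (fun j => (s : ℝ) + j * p) M)
    (linPoly (((N : ℝ) + 1) * s) (fun j => ((s : ℝ) + m) + j * p) M)
    (linPoly ((m : ℝ) + s) (fun j => (0 : ℝ) + j * p) M)
    (linPoly ((m : ℝ) + (N + 1) * s) (fun j => (m : ℝ) + j * p) M)
    (linPoly ((l : ℝ) + p) (fun j => (0 : ℝ) + j * s) N)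
    (linPoly ((l : ℝ) + (M + 1) * p) (fun j => (l : ℝ) + j * s) N)
    (linPoly (p : ℝ) (fun j => (p : ℝ) + j * s) N)
    (linPoly (((M : ℝ) + 1) * p) (fun j => ((l : ℝ) + p) + j * s) N)
    _ _ _ _ (ratSer_mul _ _ _ _ _) (ratSer_mul _ _ _ _ _) (ratSer_mul _ _ _ _ _)
    (ratSer_mul _ _ _ _ _)
    (fun k => (linPoly_eval_pos _ _ _ _ (by positivity) (by positivity)
      (fun j => by positivity)).ne')
    (fun k => (linPoly_eval_pos _ _ _ _ (by positivity) (by positivity)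
      (fun j => by positivity)).ne')
    (fun k => (linPoly_eval_pos _ _ _ _ (by positivity) (by positivity)
      (fun j => by positivity)).ne')
    (fun k => (linPoly_eval_pos _ _ _ _ (by positivity) (by positivity)
      (fun j => by positivity)).ne')
    c1 c2 (by
      intro k
      have h := hProd k
      rw [ProdEq, R1, R2, R3, R4, P1, P2, P3, P4] at h
      have hx : (0 : ℝ) < (k : ℝ) + 1 := by positivity
      rw [← ratio_eval _ _ _ _ _ _ hx, ← ratio_eval _ _ _ _ _ _ hx, ← ratio_eval _ _ _ _ _ _ hx,
        ← ratio_eval _ _ _ _ _ _ hx]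
      convert h using 3
      all_goals
        congr 1
        · congr 1 <;> ring
        · refine Finset.prod_congr rfl fun j _ => ?_
          congr 1 <;> ring)
  generalize hf1 : ratSer (s : ℝ) (((N : ℝ) + 1) * s) _ _ M = f1 at key
  generalize hf2 : ratSer ((m : ℝ) + s) ((m : ℝ) + (N + 1) * s) _ _ M = f2 at key
  generalize hf3 : ratSer ((l : ℝ) + p) ((l : ℝ) + (M + 1) * p) _ _ N = f3 at key
  generalize hf4 : ratSer (p : ℝ) (((M : ℝ) + 1) * p) _ _ N = f4 at key
  have g1 := ratSer_coeffs _ _ _ _ _ _ _ hf1.symm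
  have g2 := ratSer_coeffs _ _ _ _ _ _ _ hf2.symm
  have g3 := ratSer_coeffs _ _ _ _ _ _ _ hf3.symm
  have g4 := ratSer_coeffs _ _ _ _ _ _ _ hf4.symm
  have k2 := key 2
  have k3 := key 3
  have k5 := key 5
  clear key hProd hf1 hf2 hf3 hf4
  obtain ⟨q1, q2, q3, q4, q5, hq1, hq2, hq3, hq4, hq5, A2, A3, A5⟩ := g1
  obtain ⟨r1, r2, r3, r4, r5, hr1, hr2, hr3, hr4, hr5, B2, B3, B5⟩ := g2
  obtain ⟨t1, t2, t3, t4, t5, ht1, ht2, ht3, ht4, ht5, C2, C3, C5⟩ := g3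
  obtain ⟨u1, u2, u3, u4, u5, hu1, hu2, hu3, hu4, hu5, D2, D3, D5⟩ := g4
  rw [A2, B2, C2, D2] at k2
  rw [A3, B3, C3, D3] at k3
  rw [A5, B5, C5, D5] at k5
  clear A2 A3 A5 B2 B3 B5 C2 C3 C5 D2 D3 D5
  obtain ⟨d, rfl⟩ := Nat.exists_eq_add_of_lt hps
  obtain rfl : l = m + d + 1 := by omega
  suffices h : m = p ∧ c1 = c2 by
    exact ⟨h.1, by omega, h.2⟩
  push_cast at *
  have hp' : (0 : ℝ) < p := by exact_mod_cast hp
  have hm' : (0 : ℝ) < m := by exact_mod_cast hm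
  have hM' : (0 : ℝ) < M := by exact_mod_cast hM
  have hd' : (0 : ℝ) < (d : ℝ) + 1 := by positivity
  clear hs hl hps hml hsum hp hm hM
  rw [← @Nat.cast_inj ℝ _ _ m p]
  generalize (p : ℝ) = P at *
  generalize (m : ℝ) = Q at *
  simp only [add_assoc _ (d : ℝ) 1] at *
  generalize (d : ℝ) + 1 = D at *
  obtain ⟨κ, hκ⟩ : ∃ κ, κ = c1 / ((Q + D) * P) := ⟨_, rfl⟩
  have hκ1 : c1 = κ * ((Q + D) * P) := by rw [hκ]; field_simp
  have hκ0 : κ ≠ 0 := by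
    rintro rfl
    exact hc1 (by simpa using hκ1)
  by_cases hMN : N = M
  · subst hMN
    generalize (N : ℝ) = n at *
    have h3 : (c1 * (Q * (P + D)) - c2 * ((Q + D) * P)) * (n * (n + 1) * D) = 0 := by
      subst hq1 hq2 hq3 hr1 hr2 hr3 ht1 ht2 ht3 hu1 hu2 hu3
      linear_combination k3
    have h3' : c1 * (Q * (P + D)) - c2 * ((Q + D) * P) = 0 :=
      (mul_eq_zero.1 h3).resolve_right (by positivity)
    have hc : c2 = κ * (Q * (P + D)) := by
      have : (Q + D) * P ≠ 0 := by positivity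
      apply mul_right_cancel₀ this
      rw [hκ1] at h3'
      linear_combination -h3'
    have h5 : κ * ((Q + D) * P * (Q * (P + D)) * D ^ 2 * (n * (n + 1) * (n ^ 2 + n + 2)))
        * (Q - P) = 0 := by
      rw [hκ1, hc] at k5
      have a1 : r1 = q1 := by subst hq1 hr1; ring
      have a2 : t1 = q1 := by subst hq1 ht1; ring
      have a3 : u1 = q1 := by subst hq1 hu1; ring
      have b1 : r2 = q2 := by subst hq2 hr2; ring
      have b2 : u2 = t2 := by subst hu2 ht2; ring
      rw [a1, a2, a3, b1, b2] at k5
      subst hq1 hq2 hq3 hr3 ht2 ht3 hu3 hq4 hr4 ht4 hu4 hq5 hr5 ht5 hu5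
      linear_combination -2 * k5
    have hQP : Q = P := by
      have := (mul_eq_zero.1 h5).resolve_left (mul_ne_zero hκ0 (by positivity))
      linarith
    refine ⟨hQP, ?_⟩
    rw [hκ1, hc, hQP]; ring
  · have hNM : (N : ℝ) - M ≠ 0 := by
      rw [sub_ne_zero]; exact_mod_cast hMN
    generalize (N : ℝ) = n at *
    generalize (M : ℝ) = n' at *
    have h3 : (c1 * (Q * (P + D)) - c2 * ((Q + D) * P)) * (n - n') = 0 := by
      subst hq1 hq2 hr1 hr2 ht1 ht2 hu1 hu2
      linear_combination -k2
    have h3' : c1 * (Q * (P + D)) - c2 * ((Q + D) * P) = 0 :=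
      (mul_eq_zero.1 h3).resolve_right hNM
    have hc : c2 = κ * (Q * (P + D)) := by
      have : (Q + D) * P ≠ 0 := by positivity
      apply mul_right_cancel₀ this
      rw [hκ1] at h3'
      linear_combination -h3'
    have h5 : κ * ((Q + D) * P * (Q * (P + D)) * (n - n') ^ 2) * (Q - P) = 0 := by
      rw [hκ1, hc] at k3
      subst hq1 hq2 hq3 hr1 hr2 hr3 ht1 ht2 ht3 hu1 hu2 hu3
      linear_combination -k3
    have hQP : Q = P := by
      have := (mul_eq_zero.1 h5).resolve_left (mul_ne_zero hκ0 (by positivity))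
      linarith
    refine ⟨hQP, ?_⟩
    rw [hκ1, hc, hQP]; ring
end

section
/- Let p, s, M, N be positive integers with p < s, and set m = p and l = s. Then for every natural number k, R₁(k)P₁(k) − R₂(k)P₂(k) = R₃(k)P₃(k) − R₄(k)P₄(k), and both sides equal (k+s+1)(k+s+p+1)/((k+(N+1)s+1)(k+s+(M+1)p+1)) − (k+p+1)(k+p+s+1)/((k+(M+1)p+1)(k+p+(N+1)s+1)). In particular, Equation (Prod) holds at every k whenever c₁ = c₂. -/
open Finset

/-- The telescoping product behind all four products. -/
lemma tele_aux (a q : ℝ) (ha : 0 < a) (hq : 0 ≤ q) (n : ℕ) :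
    ∏ j ∈ Finset.Icc 1 n, ((a + j * q) / (a + q + j * q)) = (a + q) / (a + (n + 1) * q) := by
  induction n with
  | zero =>
    have h : a + q ≠ 0 := by positivity
    simp [h]
  | succ n ih =>
    rw [Finset.prod_Icc_succ_top (by omega), ih]
    push_cast
    have h1 : a + (n + 1) * q ≠ 0 := by positivity
    have h2 : a + q + (n + 1) * q ≠ 0 := by positivity
    have h3 : a + (n + 1 + 1) * q ≠ 0 := by positivity
    field_simp
    ring

/-- with `m = p` and `l = s` the two sides of Equation (Prod)
coincide, both equal the displayed explicit expression, and Equation (Prod)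
holds at every `k` whenever `c₁ = c₂`. -/
theorem prodEq_of_eq_degrees (p s M N : ℕ)
    (hp : 0 < p) (hs : 0 < s) (hM : 0 < M) (hN : 0 < N) (hps : p < s) :
    (∀ k : ℕ,
      R1 s N k * P1 p s p M k - R2 s p N k * P2 p p M k =
        R3 p s M k * P3 s s N k - R4 p M k * P4 p s s N k ∧
      R1 s N k * P1 p s p M k - R2 s p N k * P2 p p M k =
        ((k + s + 1 : ℝ) * (k + s + p + 1)) /
            ((k + (N + 1) * s + 1) * (k + s + (M + 1) * p + 1)) -
          ((k + p + 1 : ℝ) * (k + p + s + 1)) /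
            ((k + (M + 1) * p + 1) * (k + p + (N + 1) * s + 1))) ∧
    ∀ c1 c2 : ℝ, c1 = c2 → ∀ k : ℕ, ProdEq p s p s M N c1 c2 k := by
  have e1 : ∀ k : ℕ, P1 p s p M k = (k + s + p + 1) / (k + s + (M + 1) * p + 1) := by
    intro k
    have h := tele_aux (k + s + 1) p (by positivity) (by positivity) M
    unfold P1
    convert h using 2 <;> first | ring | (congr 1 <;> ring) | (funext j; congr 1 <;> ring)
  have e2 : ∀ k : ℕ, P2 p p M k = (k + p + 1) / (k + (M + 1) * p + 1) := by
    intro k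
    have h := tele_aux (k + 1) p (by positivity) (by positivity) M
    unfold P2
    convert h using 2 <;> first | ring | (congr 1 <;> ring) | (funext j; congr 1 <;> ring)
  have e3 : ∀ k : ℕ, P3 s s N k = (k + s + 1) / (k + (N + 1) * s + 1) := by
    intro k
    have h := tele_aux (k + 1) s (by positivity) (by positivity) N
    unfold P3
    convert h using 2 <;> first | ring | (congr 1 <;> ring) | (funext j; congr 1 <;> ring)
  have e4 : ∀ k : ℕ, P4 p s s N k = (k + p + s + 1) / (k + p + (N + 1) * s + 1) := by
    intro k
    have h := tele_aux (k + p + 1) s (by positivity) (by positivity) N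
    unfold P4
    convert h using 2 <;> first | ring | (congr 1 <;> ring) | (funext j; congr 1 <;> ring)
  have key : ∀ k : ℕ, R1 s N k * P1 p s p M k - R2 s p N k * P2 p p M k =
        R3 p s M k * P3 s s N k - R4 p M k * P4 p s s N k := by
    intro k
    rw [e1, e2, e3, e4]
    unfold R1 R2 R3 R4
    ring
  refine ⟨fun k => ⟨key k, ?_⟩, ?_⟩
  · rw [e1, e2]
    unfold R1 R2
    rw [div_mul_div_comm, div_mul_div_comm, mul_comm (k + p + s + 1 : ℝ),
      mul_comm (k + p + (N + 1) * s + 1 : ℝ)]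
  · rintro c1 c2 rfl k
    unfold ProdEq
    rw [key k]
end

section
/- Let p, s, M, N be positive integers with p < s. Then there exists a natural number k such that (k+s+1)(k+s+p+1)(k+(M+1)p+1)(k+p+(N+1)s+1) ≠ (k+p+1)(k+p+s+1)(k+(N+1)s+1)(k+s+(M+1)p+1); equivalently, (k+s+1)(k+s+p+1)/((k+(N+1)s+1)(k+s+(M+1)p+1)) − (k+p+1)(k+p+s+1)/((k+(M+1)p+1)(k+p+(N+1)s+1)) ≠ 0 for some k. -/
/-- there is some `k` at which the cross products differ,
equivalently the difference of the two fractions is nonzero. -/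
theorem exists_noncommuting_index (p s M N : ℕ)
    (hp : 0 < p) (hs : 0 < s) (hM : 0 < M) (hN : 0 < N) (hps : p < s) :
    ∃ k : ℕ,
      ((k + s + 1 : ℝ) * (k + s + p + 1) * (k + (M + 1) * p + 1) *
          (k + p + (N + 1) * s + 1)) ≠
        ((k + p + 1 : ℝ) * (k + p + s + 1) * (k + (N + 1) * s + 1) *
          (k + s + (M + 1) * p + 1)) ∧
      ((k + s + 1 : ℝ) * (k + s + p + 1)) /
            ((k + (N + 1) * s + 1) * (k + s + (M + 1) * p + 1)) -
          ((k + p + 1 : ℝ) * (k + p + s + 1)) /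
            ((k + (M + 1) * p + 1) * (k + p + (N + 1) * s + 1)) ≠ 0 := by
  have hp' : (0 : ℝ) < p := by exact_mod_cast hp
  have hs' : (0 : ℝ) < s := by exact_mod_cast hs
  have hM' : (0 : ℝ) < M := by exact_mod_cast hM
  have hN' : (0 : ℝ) < N := by exact_mod_cast hN
  have hps' : (p : ℝ) < s := by exact_mod_cast hps
  have key : ∃ k : ℕ,
      ((k + s + 1 : ℝ) * (k + s + p + 1) * (k + (M + 1) * p + 1) *
          (k + p + (N + 1) * s + 1)) ≠
        ((k + p + 1 : ℝ) * (k + p + s + 1) * (k + (N + 1) * s + 1) *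
          (k + s + (M + 1) * p + 1)) := by
    by_contra! h
    obtain ⟨a, ha⟩ : ∃ a : ℝ, a = (M + 1) * p := ⟨_, rfl⟩
    obtain ⟨b, hb⟩ : ∃ b : ℝ, b = (N + 1) * s := ⟨_, rfl⟩
    have ha0 : 0 < a := by rw [ha]; positivity
    have hbs : s < b := by rw [hb]; nlinarith [mul_pos hN' hs']
    simp only [← ha, ← hb] at h
    have lin : ∀ k : ℕ, (s * a - p * b) * ((k : ℝ) + 1) +
        (s * a * (p + b) - p * b * (s + a)) = 0 := by
      intro k
      have h1 : (k + s + p + 1 : ℝ) ≠ 0 := by positivity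
      apply mul_left_cancel₀ h1
      linear_combination h k
    have l0 := lin 0
    have l1 := lin 1
    push_cast at l0 l1
    have e1 : (s : ℝ) * a = p * b := by linear_combination l1 - l0
    have e2 : (p : ℝ) + b = s + a := by
      have h1 : (s : ℝ) * a ≠ 0 := by positivity
      apply mul_left_cancel₀ h1
      linear_combination l0 - (1 + s + a) * e1
    have e3 : ((s : ℝ) - p) * (b - s) = 0 := by
      linear_combination s * e2 + e1
    have : 0 < ((s : ℝ) - p) * (b - s) := mul_pos (by linarith) (by linarith)
    linarith
  obtain ⟨k, hk⟩ := key
  refine ⟨k, hk, ?_⟩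
  intro h
  apply hk
  rw [sub_eq_zero, div_eq_div_iff (by positivity) (by positivity)] at h
  linear_combination h
end

section
/- Let p, s, m, l, M, N be positive integers with p < s, m < l, l + p = m + s, and suppose that m is not an integer multiple of p (there is no positive integer t with m = t·p). Then for any nonzero real numbers c₁, c₂ there exists a natural number k at which Equation (Prod) fails, i.e., c₁·(R₁(k)P₁(k) − R₂(k)P₂(k)) ≠ c₂·(R₃(k)P₃(k) − R₄(k)P₄(k)). -/
open Finset

open Polynomial in
/-- A linear factor times a product of linear factors. -/
noncomputable def linProd (a : ℝ) (f : ℕ → ℝ) (S : Finset ℕ) : ℝ[X] :=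
  (X + C a) * ∏ j ∈ S, (X + C (f j))

lemma linProd_eval (a : ℝ) (f : ℕ → ℝ) (S : Finset ℕ) (x : ℝ) :
    (linProd a f S).eval x = (x + a) * ∏ j ∈ S, (x + f j) := by
  simp [linProd, Polynomial.eval_prod]

lemma linProd_ne {a : ℝ} {f : ℕ → ℝ} {S : Finset ℕ} {x : ℝ}
    (ha : x + a ≠ 0) (hf : ∀ j ∈ S, x + f j ≠ 0) : (linProd a f S).eval x ≠ 0 := by
  rw [linProd_eval]
  exact mul_ne_zero ha (Finset.prod_ne_zero_iff.2 hf)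

lemma linProd_pos {a : ℝ} {f : ℕ → ℝ} {S : Finset ℕ} {x : ℝ}
    (ha : 0 < x + a) (hf : ∀ j ∈ S, 0 < x + f j) : (linProd a f S).eval x ≠ 0 :=
  linProd_ne ha.ne' (fun j hj => (hf j hj).ne')

open Polynomial in
lemma poly_key (A1 B1 A2 B2 A3 B3 A4 B4 : ℝ[X]) (c1 c2 : ℝ)
    (h1 : ∀ k : ℕ, B1.eval (k : ℝ) ≠ 0) (h2 : ∀ k : ℕ, B2.eval (k : ℝ) ≠ 0)
    (h3 : ∀ k : ℕ, B3.eval (k : ℝ) ≠ 0) (h4 : ∀ k : ℕ, B4.eval (k : ℝ) ≠ 0)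
    (h : ∀ k : ℕ, c1 * (A1.eval (k : ℝ) / B1.eval (k : ℝ) - A2.eval (k : ℝ) / B2.eval (k : ℝ)) =
      c2 * (A3.eval (k : ℝ) / B3.eval (k : ℝ) - A4.eval (k : ℝ) / B4.eval (k : ℝ))) (x : ℝ) :
    c1 * (A1.eval x * B2.eval x - A2.eval x * B1.eval x) * (B3.eval x * B4.eval x) =
      c2 * (A3.eval x * B4.eval x - A4.eval x * B3.eval x) * (B1.eval x * B2.eval x) := by
  have hz : C c1 * (A1 * B2 - A2 * B1) * (B3 * B4) - C c2 * (A3 * B4 - A4 * B3) * (B1 * B2) = 0 := by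
    apply Polynomial.eq_zero_of_infinite_isRoot
    refine Set.Infinite.mono ?_ (Set.infinite_range_of_injective (Nat.cast_injective (R := ℝ)))
    rintro _ ⟨k, rfl⟩
    have hk := h k
    have := h1 k
    have := h2 k
    have := h3 k
    have := h4 k
    rw [div_sub_div _ _ (h1 k) (h2 k), div_sub_div _ _ (h3 k) (h4 k), ← mul_div_assoc,
      ← mul_div_assoc, div_eq_div_iff (mul_ne_zero (h1 k) (h2 k)) (mul_ne_zero (h3 k) (h4 k))] at hk
    simp only [Set.mem_ofPred_eq, IsRoot.def, eval_sub, eval_mul, eval_C]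
    linear_combination hk
  have := congrArg (fun q => q.eval x) hz
  simp only [eval_sub, eval_mul, eval_C, eval_zero] at this
  linear_combination this

lemma RP1 (p s m M N k : ℕ) : R1 s N k * P1 p s m M k =
    (linProd (s + 1) (fun j => s + j * p + 1) (Finset.Icc 1 M)).eval (k : ℝ) /
    (linProd ((N + 1) * s + 1) (fun j => s + m + j * p + 1) (Finset.Icc 1 M)).eval (k : ℝ) := by
  simp only [R1, P1, linProd_eval, Finset.prod_div_distrib, div_mul_div_comm, add_assoc]

lemma RP2 (p s m M N k : ℕ) : R2 s m N k * P2 p m M k =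
    (linProd (m + s + 1) (fun j => j * p + 1) (Finset.Icc 1 M)).eval (k : ℝ) /
    (linProd (m + (N + 1) * s + 1) (fun j => m + j * p + 1) (Finset.Icc 1 M)).eval (k : ℝ) := by
  simp only [R2, P2, linProd_eval, Finset.prod_div_distrib, div_mul_div_comm, add_assoc]

lemma RP3 (p s l M N k : ℕ) : R3 p l M k * P3 s l N k =
    (linProd (l + p + 1) (fun j => j * s + 1) (Finset.Icc 1 N)).eval (k : ℝ) /
    (linProd (l + (M + 1) * p + 1) (fun j => l + j * s + 1) (Finset.Icc 1 N)).eval (k : ℝ) := by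
  simp only [R3, P3, linProd_eval, Finset.prod_div_distrib, div_mul_div_comm, add_assoc]

lemma RP4 (p s l M N k : ℕ) : R4 p M k * P4 p s l N k =
    (linProd (p + 1) (fun j => p + j * s + 1) (Finset.Icc 1 N)).eval (k : ℝ) /
    (linProd ((M + 1) * p + 1) (fun j => l + p + j * s + 1) (Finset.Icc 1 N)).eval (k : ℝ) := by
  simp only [R4, P4, linProd_eval, Finset.prod_div_distrib, div_mul_div_comm, add_assoc]

/-- A pole at `-(m + i p + 1)` occurring only in the second term. -/
lemma single_pole (p s m l M N i : ℕ) (c1 c2 : ℝ) (hc1 : c1 ≠ 0)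
    (hi : 1 ≤ i) (hiM : i ≤ M)
    (e1 : s ≠ i * p) (e2 : (N + 1) * s ≠ m + i * p)
    (e3 : ∀ j, 1 ≤ j → s + m + j * p ≠ m + i * p)
    (e4 : ∀ j, j * p ≠ m + i * p)
    (e5 : l + (M + 1) * p ≠ m + i * p)
    (e6 : ∀ j, 1 ≤ j → l + j * s ≠ m + i * p)
    (e7 : ∀ j, 1 ≤ j → l + p + j * s ≠ m + i * p)
    (h : ∀ k, ProdEq p s m l M N c1 c2 k) : False := by
  simp only [ProdEq, RP1, RP2, RP3, RP4] at h
  have key := poly_key _ _ _ _ _ _ _ _ c1 c2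
    (fun k => linProd_pos (by positivity) (fun j _ => by positivity))
    (fun k => linProd_pos (by positivity) (fun j _ => by positivity))
    (fun k => linProd_pos (by positivity) (fun j _ => by positivity))
    (fun k => linProd_pos (by positivity) (fun j _ => by positivity)) h (-(m + i * p + 1))
  have hB2 : (linProd (m + (N + 1) * s + 1) (fun j => (m : ℝ) + j * p + 1)
      (Finset.Icc 1 M)).eval (-(m + i * p + 1) : ℝ) = 0 := by
    rw [linProd_eval]
    apply mul_eq_zero_of_right
    exact Finset.prod_eq_zero (Finset.mem_Icc.2 ⟨hi, hiM⟩) (by ring)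
  rw [hB2] at key
  have hA2 : (linProd (m + s + 1) (fun j => (j : ℝ) * p + 1)
      (Finset.Icc 1 M)).eval (-(m + i * p + 1) : ℝ) ≠ 0 := by
    refine linProd_ne (fun h0 => e1 ?_) (fun j _ h0 => e4 j ?_) <;> rify <;> linarith
  have hB1 : (linProd ((N + 1) * s + 1) (fun j => (s : ℝ) + m + j * p + 1)
      (Finset.Icc 1 M)).eval (-(m + i * p + 1) : ℝ) ≠ 0 := by
    refine linProd_ne (fun h0 => e2 ?_)
      (fun j hj h0 => e3 j (Finset.mem_Icc.1 hj).1 ?_) <;> rify <;> linarith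
  have hB3 : (linProd (l + (M + 1) * p + 1) (fun j => (l : ℝ) + j * s + 1)
      (Finset.Icc 1 N)).eval (-(m + i * p + 1) : ℝ) ≠ 0 := by
    refine linProd_ne (fun h0 => e5 ?_)
      (fun j hj h0 => e6 j (Finset.mem_Icc.1 hj).1 ?_) <;> rify <;> linarith
  have hB4 : (linProd ((M + 1) * p + 1) (fun j => (l : ℝ) + p + j * s + 1)
      (Finset.Icc 1 N)).eval (-(m + i * p + 1) : ℝ) ≠ 0 := by
    refine linProd_ne (fun h0 => e4 (M + 1) ?_)
      (fun j hj h0 => e7 j (Finset.mem_Icc.1 hj).1 ?_) <;> rify <;> linarith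
  have : c1 * (_ * _) * (_ * _) ≠ 0 :=
    mul_ne_zero (mul_ne_zero hc1 (mul_ne_zero hA2 hB1)) (mul_ne_zero hB3 hB4)
  apply this
  linear_combination -key

open Polynomial in
/-- The pole `-(m + p + 1)` occurs in both terms on the left. -/
lemma double_pole (p s m l M N : ℕ) (c1 c2 : ℝ) (hc1 : c1 ≠ 0)
    (hp : 0 < p) (hm : 0 < m) (hM : 0 < M) (hN : 0 < N) (hps : p < s)
    (e2 : (N + 1) * s = m + p)
    (e4 : ∀ j, j * p ≠ m + p)
    (e5 : l + (M + 1) * p ≠ m + p)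
    (e6 : ∀ j, 1 ≤ j → l + j * s ≠ m + p)
    (e7 : ∀ j, 1 ≤ j → l + p + j * s ≠ m + p)
    (hU : (∃ j, 1 ≤ j ∧ j ≤ M ∧ N * s = j * p) ∨ (∀ j, 1 ≤ j → j ≤ M → j * p < N * s))
    (h : ∀ k, ProdEq p s m l M N c1 c2 k) : False := by
  have e2r : ((N : ℝ) + 1) * s = m + p := by exact_mod_cast e2
  have hpr : (0 : ℝ) < p := by exact_mod_cast hp
  have hmr : (0 : ℝ) < m := by exact_mod_cast hm
  have hNr : (0 : ℝ) < N := by exact_mod_cast hN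
  have hpsr : (p : ℝ) < s := by exact_mod_cast hps
  simp only [ProdEq, RP1, RP2, RP3, RP4] at h
  have hIcc : Finset.Icc 1 M = insert 1 (Finset.Icc 2 M) := by
    ext j; simp only [Finset.mem_Icc, Finset.mem_insert]; omega
  have hpos : ∀ k : ℕ, (0 : ℝ) < k + (m + p + 1) := fun k => by positivity
  have key := poly_key
    (linProd (s + 1) (fun j => s + j * p + 1) (Finset.Icc 1 M))
    (∏ j ∈ Finset.Icc 1 M, (X + C ((s : ℝ) + m + j * p + 1)))
    (linProd (m + s + 1) (fun j => j * p + 1) (Finset.Icc 1 M))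
    (linProd (m + (N + 1) * s + 1) (fun j => m + j * p + 1) (Finset.Icc 2 M))
    ((X + C ((m : ℝ) + p + 1)) * linProd (l + p + 1) (fun j => j * s + 1) (Finset.Icc 1 N))
    (linProd (l + (M + 1) * p + 1) (fun j => l + j * s + 1) (Finset.Icc 1 N))
    ((X + C ((m : ℝ) + p + 1)) * linProd (p + 1) (fun j => p + j * s + 1) (Finset.Icc 1 N))
    (linProd ((M + 1) * p + 1) (fun j => l + p + j * s + 1) (Finset.Icc 1 N))
    c1 c2
    (fun k => by
      rw [eval_prod]
      exact Finset.prod_ne_zero_iff.2 (fun j _ => by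
        simp only [eval_add, eval_X, eval_C]; positivity))
    (fun k => linProd_pos (by positivity) (fun j _ => by positivity))
    (fun k => linProd_pos (by positivity) (fun j _ => by positivity))
    (fun k => linProd_pos (by positivity) (fun j _ => by positivity))
    (fun k => by
      have hk := h k
      have hb1 : (linProd ((N + 1) * s + 1) (fun j => (s : ℝ) + m + j * p + 1)
          (Finset.Icc 1 M)).eval (k : ℝ) = ((k : ℝ) + (m + p + 1)) *
          (∏ j ∈ Finset.Icc 1 M, (X + C ((s : ℝ) + m + j * p + 1))).eval (k : ℝ) := by
        rw [linProd_eval, eval_prod, e2r]; simp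
      have hb2 : (linProd (m + (N + 1) * s + 1) (fun j => (m : ℝ) + j * p + 1)
          (Finset.Icc 1 M)).eval (k : ℝ) = ((k : ℝ) + (m + p + 1)) *
          (linProd (m + (N + 1) * s + 1) (fun j => (m : ℝ) + j * p + 1)
          (Finset.Icc 2 M)).eval (k : ℝ) := by
        rw [linProd_eval, linProd_eval, hIcc, Finset.prod_insert (by simp)]; push_cast; ring
      rw [hb1, hb2] at hk
      have hne := (hpos k).ne'
      simp only [eval_mul, eval_add, eval_X, eval_C]
      rw [← mul_div_mul_left _ (eval (k : ℝ) (∏ j ∈ Finset.Icc 1 M, _)) hne,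
        ← mul_div_mul_left _ (eval (k : ℝ) (linProd (m + (N + 1) * s + 1) _ _)) hne]
      simp only [mul_div_assoc]
      linear_combination ((k : ℝ) + (m + p + 1)) * hk) (-(m + p + 1))
  have hB3 : (linProd (l + (M + 1) * p + 1) (fun j => (l : ℝ) + j * s + 1)
      (Finset.Icc 1 N)).eval (-(m + p + 1) : ℝ) ≠ 0 := by
    refine linProd_ne (fun h0 => e5 ?_)
      (fun j hj h0 => e6 j (Finset.mem_Icc.1 hj).1 ?_) <;> rify <;> linarith
  have hB4 : (linProd ((M + 1) * p + 1) (fun j => (l : ℝ) + p + j * s + 1)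
      (Finset.Icc 1 N)).eval (-(m + p + 1) : ℝ) ≠ 0 := by
    refine linProd_ne (fun h0 => e4 (M + 1) ?_)
      (fun j hj h0 => e7 j (Finset.mem_Icc.1 hj).1 ?_) <;> rify <;> linarith
  simp only [eval_mul, eval_add, eval_X, eval_C, neg_add_cancel, zero_mul, sub_zero, mul_zero,
    sub_self] at key
  have key2 := (mul_eq_zero.1 ((mul_eq_zero.1 key).resolve_right
    (mul_ne_zero hB3 hB4))).resolve_left hc1
  simp only [linProd_eval, eval_prod, eval_add, eval_X, eval_C] at key2
  -- signs
  have hA1 : ∏ j ∈ Finset.Icc 1 M, (-((m : ℝ) + p + 1) + (s + j * p + 1)) =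
      (-1) ^ (Finset.Icc 1 M).card * ∏ j ∈ Finset.Icc 1 M, ((N : ℝ) * s - j * p) := by
    rw [← Finset.prod_neg]
    exact Finset.prod_congr rfl (fun j _ => by linear_combination e2r)
  have hA2 : ∏ j ∈ Finset.Icc 1 M, (-((m : ℝ) + p + 1) + (j * p + 1)) =
      (-1) ^ (Finset.Icc 1 M).card * ∏ j ∈ Finset.Icc 1 M, ((m : ℝ) + p - j * p) := by
    rw [← Finset.prod_neg]
    exact Finset.prod_congr rfl (fun j _ => by ring)
  rw [hA1, hA2] at key2
  have hB1 : 0 < ∏ j ∈ Finset.Icc 1 M, (-((m : ℝ) + p + 1) + (s + m + j * p + 1)) := by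
    refine Finset.prod_pos (fun j _ => ?_)
    have : (0 : ℝ) ≤ j * p := by positivity
    linarith
  have hB2 : 0 < ∏ j ∈ Finset.Icc 2 M, (-((m : ℝ) + p + 1) + (m + j * p + 1)) := by
    refine Finset.prod_pos (fun j hj => ?_)
    have : (2 : ℝ) ≤ j := by exact_mod_cast (Finset.mem_Icc.1 hj).1
    nlinarith
  have hV : ∏ j ∈ Finset.Icc 1 M, ((m : ℝ) + p - j * p) ≠ 0 := by
    refine Finset.prod_ne_zero_iff.2 (fun j _ h0 => e4 j ?_)
    rify; linarith
  set U := ∏ j ∈ Finset.Icc 1 M, ((N : ℝ) * s - j * p) with hUdef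
  set V := ∏ j ∈ Finset.Icc 1 M, ((m : ℝ) + p - j * p) with hVdef
  set b1 := ∏ j ∈ Finset.Icc 1 M, (-((m : ℝ) + p + 1) + (s + m + j * p + 1))
  set b2 := ∏ j ∈ Finset.Icc 2 M, (-((m : ℝ) + p + 1) + (m + j * p + 1))
  have hsg : ((-1 : ℝ)) ^ (Finset.Icc 1 M).card ≠ 0 := pow_ne_zero _ (by norm_num)
  have key3 : (s - p : ℝ) * V * b1 + N * s * U * (m * b2) = 0 := by
    apply (mul_eq_zero.1 (_ : (-1 : ℝ) ^ (Finset.Icc 1 M).card * _ = 0)).resolve_left hsg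
    have h1 : -((m : ℝ) + p + 1) + (s + 1) = - (N * s) := by linear_combination e2r
    have h2 : -((m : ℝ) + p + 1) + (m + (N + 1) * s + 1) = m := by linear_combination e2r
    rw [h1, h2] at key2
    linear_combination -key2
  have hsp : (0 : ℝ) < s - p := by linarith
  rcases hU with ⟨j, hj1, hj2, hj⟩ | hU
  · have : U = 0 := by
      refine Finset.prod_eq_zero (Finset.mem_Icc.2 ⟨hj1, hj2⟩) ?_
      have : (N : ℝ) * s = j * p := by exact_mod_cast hj
      linarith
    rw [this] at key3
    have : (s - p : ℝ) * V * b1 ≠ 0 := mul_ne_zero (mul_ne_zero hsp.ne' hV) hB1.ne'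
    apply this; linear_combination key3
  · have hf : ∀ j ∈ Finset.Icc 1 M, (0 : ℝ) < N * s - j * p := fun j hj => by
      have := hU j (Finset.mem_Icc.1 hj).1 (Finset.mem_Icc.1 hj).2
      have : (j : ℝ) * p < N * s := by exact_mod_cast this
      linarith
    have hUp : 0 < U := Finset.prod_pos hf
    have hVp : 0 < V := Finset.prod_pos (fun j hj => by
      have := hf j hj
      linarith)
    have hs0 : (0 : ℝ) < s := by linarith
    have : 0 < (s - p : ℝ) * V * b1 + N * s * U * (m * b2) := by positivity
    linarith

/-- Case I: if `m` is not a multiple of `p`, then Equation (Prod)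
fails at some `k`. -/
theorem prodEq_fails_of_not_multiple (p s m l M N : ℕ)
    (hp : 0 < p) (hs : 0 < s) (hm : 0 < m) (hl : 0 < l) (hM : 0 < M) (hN : 0 < N)
    (hps : p < s) (hml : m < l) (hsum : l + p = m + s)
    (hmult : ¬ ∃ t : ℕ, 0 < t ∧ m = t * p) :
    ∀ c1 c2 : ℝ, c1 ≠ 0 → c2 ≠ 0 → ∃ k : ℕ, ¬ ProdEq p s m l M N c1 c2 k := by
  intro c1 c2 hc1 hc2
  by_contra! h
  have hdvd : ¬ p ∣ m := by
    rintro ⟨t, ht⟩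
    refine hmult ⟨t, Nat.pos_of_ne_zero ?_, by rw [ht, mul_comm]⟩
    rintro rfl
    simp at ht; omega
  have e4 : ∀ i j, j * p ≠ m + i * p := fun i j hj => hdvd
    ((Nat.dvd_add_left (Dvd.intro_left i rfl)).1 (hj ▸ Dvd.intro_left j rfl))
  have js : ∀ j, 1 ≤ j → s ≤ j * s := fun j hj => Nat.le_mul_of_pos_left s hj
  have jp : ∀ j, 1 ≤ j → p ≤ j * p := fun j hj => Nat.le_mul_of_pos_left p hj
  have e4' : ∀ j, j * p ≠ m + p := fun j hj => e4 1 j (by rw [hj, one_mul])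
  have hMp := jp M hM
  have e5 : l + (M + 1) * p ≠ m + p := by rw [add_mul]; omega
  have e6 : ∀ j, 1 ≤ j → l + j * s ≠ m + p := fun j hj => by have := js j hj; omega
  have e7 : ∀ j, 1 ≤ j → l + p + j * s ≠ m + p := fun j hj => by have := js j hj; omega
  by_cases e2 : (N + 1) * s = m + p
  · by_cases hd : 2 ≤ M ∧ 2 * s ≠ 3 * p
    · obtain ⟨hM2, hsp⟩ := hd
      have hM2p : 2 * p ≤ M * p := Nat.mul_le_mul_right p hM2
      refine single_pole p s m l M N 2 c1 c2 hc1 (by omega) hM2 ?_ (by omega) ?_ (e4 2)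
        (by rw [add_mul]; omega) ?_ ?_ h
      · intro hs2
        apply e4' ((N + 1) * 2)
        rw [← e2, hs2, mul_assoc]
      · intro j hj
        have := jp j hj
        omega
      · intro j hj
        rcases Nat.lt_or_ge j 2 with h2 | h2
        · obtain rfl : j = 1 := by omega
          omega
        · have : 2 * s ≤ j * s := Nat.mul_le_mul_right s h2
          omega
      · intro j hj
        have := js j hj
        omega
    · refine double_pole p s m l M N c1 c2 hc1 hp hm hM hN hps e2 e4' e5 e6 e7 ?_ h
      have hNs := js N hN
      by_cases hM1 : M = 1
      · right
        intro j h1 h2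
        obtain rfl : j = 1 := by omega
        omega
      · have hsp : 2 * s = 3 * p := by
          by_contra hne
          exact hd ⟨by omega, hne⟩
        obtain ⟨n, hn | hn⟩ := Nat.even_or_odd' N
        · have hNs' : N * s = (3 * n) * p := by
            rw [hn]; linear_combination n * hsp
          rcases Nat.lt_or_ge M (3 * n) with h3 | h3
          · right
            intro j h1 h2
            rw [hNs']
            exact Nat.mul_lt_mul_of_pos_right (by omega) hp
          · left
            exact ⟨3 * n, by omega, h3, hNs'⟩
        · exfalso
          apply e4' (3 * (n + 1))
          rw [← e2, hn]; linear_combination -((n + 1) * hsp)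
  · refine single_pole p s m l M N 1 c1 c2 hc1 le_rfl hM (by omega) (by omega) ?_ (e4 1)
      (by rw [one_mul]; exact e5) ?_ ?_ h
    · intro j hj
      have := jp j hj
      omega
    · intro j hj; rw [one_mul]; exact e6 j hj
    · intro j hj; rw [one_mul]; exact e7 j hj
end

section
/- Let p, s, m, l, M, N be positive integers with p < s, m < l, l + p = m + s, and suppose m = t·p for some integer t ≥ 2. Then for any nonzero real numbers c₁, c₂ there exists a natural number k at which Equation (Prod) fails, i.e., c₁·(R₁(k)P₁(k) − R₂(k)P₂(k)) ≠ c₂·(R₃(k)P₃(k) − R₄(k)P₄(k)). -/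
open Finset

namespace CaseII

open Polynomial in
/-- `F` is (on the sample points `k+1`) a rational function regular at `-z` with value `v`. -/
def Val (F : ℕ → ℝ) (z : ℕ) (v : ℝ) : Prop :=
  ∃ n d : ℝ[X], (∀ k : ℕ, d.eval ((k : ℝ) + 1) ≠ 0 ∧
    F k * d.eval ((k : ℝ) + 1) = n.eval ((k : ℝ) + 1)) ∧
    d.eval (-(z : ℝ)) ≠ 0 ∧ v * d.eval (-(z : ℝ)) = n.eval (-(z : ℝ))

def Reg (F : ℕ → ℝ) (z : ℕ) : Prop := ∃ v, Val F z v

open Polynomial in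
lemma poly_eq (P Q : ℝ[X]) (h : ∀ k : ℕ, P.eval ((k : ℝ) + 1) = Q.eval ((k : ℝ) + 1)) : P = Q := by
  apply Polynomial.eq_of_infinite_eval_eq
  apply Set.Infinite.mono (s := Set.range (fun k : ℕ => (k : ℝ) + 1))
  · rintro _ ⟨k, rfl⟩
    exact h k
  · apply Set.infinite_range_of_injective
    intro a b hab
    simpa using hab

lemma Val.unique {F : ℕ → ℝ} {z : ℕ} {v w : ℝ} (h1 : Val F z v) (h2 : Val F z w) : v = w := by
  obtain ⟨n, d, h, hd, hv⟩ := h1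
  obtain ⟨n', d', h', hd', hv'⟩ := h2
  have : n * d' = n' * d := by
    apply poly_eq
    intro k
    simp only [Polynomial.eval_mul]
    rw [← (h k).2, ← (h' k).2]; ring
  have e := congrArg (Polynomial.eval (-(z : ℝ))) this
  simp only [Polynomial.eval_mul] at e
  rw [← hv, ← hv'] at e
  have : (v - w) * (d.eval (-(z : ℝ)) * d'.eval (-(z : ℝ))) = 0 := by linarith
  rcases mul_eq_zero.1 this with h | h
  · linarith
  · exact absurd h (mul_ne_zero hd hd')

lemma Val.const (c : ℝ) (z : ℕ) : Val (fun _ => c) z c :=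
  ⟨Polynomial.C c, 1, by simp, by simp, by simp⟩

lemma Val.mul {F G : ℕ → ℝ} {z : ℕ} {v w : ℝ} (h1 : Val F z v) (h2 : Val G z w) :
    Val (fun k => F k * G k) z (v * w) := by
  obtain ⟨n, d, h, hd, hv⟩ := h1
  obtain ⟨n', d', h', hd', hv'⟩ := h2
  refine ⟨n * n', d * d', fun k => ?_, ?_, ?_⟩
  · simp only [Polynomial.eval_mul]
    refine ⟨mul_ne_zero (h k).1 (h' k).1, ?_⟩
    rw [← (h k).2, ← (h' k).2]; ring
  · simp only [Polynomial.eval_mul]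
    exact mul_ne_zero hd hd'
  · simp only [Polynomial.eval_mul]
    rw [← hv, ← hv']; ring

lemma Val.sub {F G : ℕ → ℝ} {z : ℕ} {v w : ℝ} (h1 : Val F z v) (h2 : Val G z w) :
    Val (fun k => F k - G k) z (v - w) := by
  obtain ⟨n, d, h, hd, hv⟩ := h1
  obtain ⟨n', d', h', hd', hv'⟩ := h2
  refine ⟨n * d' - n' * d, d * d', fun k => ?_, ?_, ?_⟩
  · simp only [Polynomial.eval_mul, Polynomial.eval_sub]
    refine ⟨mul_ne_zero (h k).1 (h' k).1, ?_⟩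
    rw [← (h k).2, ← (h' k).2]; ring
  · simp only [Polynomial.eval_mul]
    exact mul_ne_zero hd hd'
  · simp only [Polynomial.eval_mul, Polynomial.eval_sub]
    rw [← hv, ← hv']; ring

lemma Val.prod {F : ℕ → ℕ → ℝ} {z : ℕ} {v : ℕ → ℝ} (S : Finset ℕ)
    (h : ∀ j ∈ S, Val (F j) z (v j)) :
    Val (fun k => ∏ j ∈ S, F j k) z (∏ j ∈ S, v j) := by
  induction S using Finset.induction_on with
  | empty => simpa using Val.const 1 z
  | insert a S ha ih =>
    simp only [Finset.prod_insert ha]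
    exact (h a (by simp)).mul (ih fun j hj => h j (by simp [hj]))

noncomputable def lin (a k : ℕ) : ℝ := (k : ℝ) + 1 + a

lemma lin_pos (a k : ℕ) : 0 < lin a k := by unfold lin; positivity

lemma lin_ne (a k : ℕ) : lin a k ≠ 0 := (lin_pos a k).ne'

lemma Val.lin (a z : ℕ) : Val (lin a) z ((a : ℝ) - z) := by
  refine ⟨Polynomial.X + Polynomial.C (a : ℝ), 1, fun k => ?_, by simp, ?_⟩
  · simp [CaseII.lin]
  · simp; ring

lemma Val.div_lin (a b z : ℕ) (h : z ≠ b) :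
    Val (fun k => CaseII.lin a k / CaseII.lin b k) z (((a : ℝ) - z) / ((b : ℝ) - z)) := by
  have hb : (b : ℝ) - z ≠ 0 := by
    intro h'
    exact h (by exact_mod_cast (sub_eq_zero.1 h').symm)
  refine ⟨Polynomial.X + Polynomial.C (a : ℝ), Polynomial.X + Polynomial.C (b : ℝ),
    fun k => ?_, ?_, ?_⟩
  · have := lin_ne b k
    simp only [Polynomial.eval_add, Polynomial.eval_X, Polynomial.eval_C]
    exact ⟨this, div_mul_cancel₀ _ this⟩
  · simp only [Polynomial.eval_add, Polynomial.eval_X, Polynomial.eval_C]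
    intro h'; apply hb; linarith
  · simp only [Polynomial.eval_add, Polynomial.eval_X, Polynomial.eval_C]
    rw [neg_add_eq_sub, neg_add_eq_sub, div_mul_cancel₀ _ hb]

/-- The common shape of all four terms. -/
noncomputable def Q (a b : ℕ) (f g : ℕ → ℕ) (n k : ℕ) : ℝ :=
  lin a k / lin b k * ∏ j ∈ Finset.Icc 1 n, (lin (f j) k / lin (g j) k)

noncomputable def qv (a b : ℕ) (f g : ℕ → ℕ) (n z : ℕ) : ℝ :=
  ((a : ℝ) - z) / ((b : ℝ) - z) *
    ∏ j ∈ Finset.Icc 1 n, (((f j : ℕ) : ℝ) - z) / (((g j : ℕ) : ℝ) - z)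

lemma Q_val (a b : ℕ) (f g : ℕ → ℕ) (n z : ℕ) (hb : z ≠ b)
    (hg : ∀ j, 1 ≤ j → j ≤ n → z ≠ g j) : Val (Q a b f g n) z (qv a b f g n z) := by
  unfold qv
  exact (Val.div_lin a b z hb).mul (Val.prod (Finset.Icc 1 n)
    (F := fun j k => lin (f j) k / lin (g j) k) fun j hj => by
      rw [Finset.mem_Icc] at hj
      exact Val.div_lin _ _ _ (hg j hj.1 hj.2))

lemma Q_pos (a b : ℕ) (f g : ℕ → ℕ) (n k : ℕ) : 0 < Q a b f g n k :=
  mul_pos (div_pos (lin_pos _ _) (lin_pos _ _))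
    (Finset.prod_pos fun _ _ => div_pos (lin_pos _ _) (lin_pos _ _))

lemma Q_inv (a b : ℕ) (f g : ℕ → ℕ) (n k : ℕ) : Q a b f g n k * Q b a g f n k = 1 := by
  unfold Q
  rw [mul_mul_mul_comm, ← Finset.prod_mul_distrib, Finset.prod_eq_one, mul_one]
  · have h1 := lin_ne a k
    have h2 := lin_ne b k
    field_simp
  · intro j _
    have h1 := lin_ne (f j) k
    have h2 := lin_ne (g j) k
    field_simp

lemma qv_zero_left (a b : ℕ) (f g : ℕ → ℕ) (n z : ℕ) (h : z = a) : qv a b f g n z = 0 := by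
  simp [qv, h]

lemma qv_zero_mem (a b : ℕ) (f g : ℕ → ℕ) (n z j : ℕ) (h1 : 1 ≤ j) (h2 : j ≤ n) (h : z = f j) :
    qv a b f g n z = 0 := by
  unfold qv
  rw [Finset.prod_eq_zero (i := j) (by simp [h1, h2]) (by simp [h]), mul_zero]

lemma sub_cast_ne {a z : ℕ} (h : z ≠ a) : (a : ℝ) - z ≠ 0 := by
  intro h'
  exact h (by exact_mod_cast (sub_eq_zero.1 h').symm)

lemma qv_ne (a b : ℕ) (f g : ℕ → ℕ) (n z : ℕ) (ha : z ≠ a) (hb : z ≠ b)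
    (hf : ∀ j, 1 ≤ j → j ≤ n → z ≠ f j) (hg : ∀ j, 1 ≤ j → j ≤ n → z ≠ g j) :
    qv a b f g n z ≠ 0 := by
  unfold qv
  refine mul_ne_zero (div_ne_zero (sub_cast_ne ha) (sub_cast_ne hb)) ?_
  rw [Finset.prod_ne_zero_iff]
  intro j hj
  rw [Finset.mem_Icc] at hj
  exact div_ne_zero (sub_cast_ne (hf j hj.1 hj.2)) (sub_cast_ne (hg j hj.1 hj.2))

/-- cancellation of the prefactor denominator against one numerator of the product -/
lemma Q_reg_cancel (a b : ℕ) (f g : ℕ → ℕ) (n z i : ℕ) (h1 : 1 ≤ i) (h2 : i ≤ n) (h : b = f i)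
    (hg : ∀ j, 1 ≤ j → j ≤ n → z ≠ g j) : Reg (Q a b f g n) z := by
  have hi : i ∈ Finset.Icc 1 n := by simp [h1, h2]
  have hz : z ≠ g i := hg i h1 h2
  · have e : Q a b f g n = fun k => (lin a k / lin (g i) k) *
        ∏ j ∈ (Finset.Icc 1 n).erase i, (lin (f j) k / lin (g j) k) := by
      funext k
      unfold Q
      rw [← Finset.mul_prod_erase _ _ hi, ← h]
      have := lin_ne b k
      have := lin_ne (g i) k
      field_simp
    rw [e]
    exact ⟨_, (Val.div_lin a (g i) z hz).mul (Val.prod _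
      (F := fun j k => lin (f j) k / lin (g j) k) fun j hj => by
        rw [Finset.mem_erase, Finset.mem_Icc] at hj
        exact Val.div_lin _ _ _ (hg j hj.2.1 hj.2.2))⟩

lemma prod_shift (g : ℕ → ℝ) (hg : ∀ j, g j ≠ 0) (M t : ℕ) :
    ∏ j ∈ Finset.Icc 1 M, g j / g (t + j) = ∏ j ∈ Finset.Icc 1 t, g j / g (M + j) := by
  have key : ∀ n, ∀ f : ℕ → ℝ, ∏ j ∈ Finset.Icc 1 n, f j = ∏ j ∈ Finset.range n, f (j + 1) := by
    intro n f
    induction n with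
    | zero => simp
    | succ n ih => rw [Finset.prod_Icc_succ_top (by omega), ih, Finset.prod_range_succ]
  rw [Finset.prod_div_distrib, Finset.prod_div_distrib, div_eq_div_iff
    (Finset.prod_ne_zero_iff.2 fun _ _ => hg _) (Finset.prod_ne_zero_iff.2 fun _ _ => hg _)]
  simp only [key]
  have h1 := Finset.prod_range_add (fun j => g (j + 1)) M t
  have h2 := Finset.prod_range_add (fun j => g (j + 1)) t M
  simp only [add_assoc] at h1 h2
  rw [← h1, ← h2, add_comm]

lemma Q_shift (a b : ℕ) (h : ℕ → ℕ) (M t : ℕ) :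
    Q a b h (fun j => h (t + j)) M = Q a b h (fun j => h (M + j)) t := by
  funext k
  unfold Q
  rw [prod_shift (fun j => lin (h j) k) (fun j => lin_ne _ _)]

section abstract_eq
variable {c1 c2 : ℝ} {F1 F2 F3 F4 : ℕ → ℝ}

lemma eq_val (h : ∀ k, c1 * (F1 k - F2 k) = c2 * (F3 k - F4 k)) {z : ℕ} {v1 v2 v3 v4 : ℝ}
    (h1 : Val F1 z v1) (h2 : Val F2 z v2) (h3 : Val F3 z v3) (h4 : Val F4 z v4) :
    c1 * (v1 - v2) = c2 * (v3 - v4) := by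
  have a := (Val.const c1 z).mul (h1.sub h2)
  have b := (Val.const c2 z).mul (h3.sub h4)
  have : (fun k => c1 * (F1 k - F2 k)) = (fun k => c2 * (F3 k - F4 k)) := funext h
  rw [this] at a
  exact a.unique b

lemma pole2 (h : ∀ k, c1 * (F1 k - F2 k) = c2 * (F3 k - F4 k)) {z : ℕ} {G : ℕ → ℝ}
    (hG : ∀ k, F2 k * G k = 1) (h1 : Reg F1 z) (h3 : Reg F3 z) (h4 : Reg F4 z)
    (hg : Val G z 0) : c1 = 0 := by
  obtain ⟨v1, h1⟩ := h1
  obtain ⟨v3, h3⟩ := h3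
  obtain ⟨v4, h4⟩ := h4
  have := eq_val (c1 := c1) (c2 := c2) (F1 := fun k => F1 k * G k) (F2 := fun _ => 1)
    (F3 := fun k => F3 k * G k) (F4 := fun k => F4 k * G k) (fun k => by
      rw [← hG k]; linear_combination (G k) * h k)
    (h1.mul hg) (Val.const 1 z) (h3.mul hg) (h4.mul hg)
  linarith

lemma pole4 (h : ∀ k, c1 * (F1 k - F2 k) = c2 * (F3 k - F4 k)) {z : ℕ} {G : ℕ → ℝ}
    (hG : ∀ k, F4 k * G k = 1) (h1 : Reg F1 z) (h2 : Reg F2 z) (h3 : Reg F3 z)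
    (hg : Val G z 0) : c2 = 0 := by
  obtain ⟨v1, h1⟩ := h1
  obtain ⟨v3, h3⟩ := h3
  obtain ⟨v2, h2⟩ := h2
  have := eq_val (c1 := c1) (c2 := c2) (F1 := fun k => F1 k * G k) (F4 := fun _ => 1)
    (F3 := fun k => F3 k * G k) (F2 := fun k => F2 k * G k) (fun k => by
      rw [← hG k]; linear_combination (G k) * h k)
    (h1.mul hg) (h2.mul hg) (h3.mul hg) (Val.const 1 z)
  linarith

/-- if `F1 / F2` has value `w` and `F2` has a pole, then `w = 1` -/
lemma pole12 (h : ∀ k, c1 * (F1 k - F2 k) = c2 * (F3 k - F4 k)) {z : ℕ} {G : ℕ → ℝ} {w : ℝ}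
    (hG : ∀ k, F2 k * G k = 1) (h1 : Val (fun k => F1 k * G k) z w) (h3 : Reg F3 z)
    (h4 : Reg F4 z) (hg : Val G z 0) (hc : c1 ≠ 0) : w = 1 := by
  obtain ⟨v3, h3⟩ := h3
  obtain ⟨v4, h4⟩ := h4
  have := eq_val (c1 := c1) (c2 := c2) (F1 := fun k => F1 k * G k) (F2 := fun _ => 1)
    (F3 := fun k => F3 k * G k) (F4 := fun k => F4 k * G k) (fun k => by
      rw [← hG k]; linear_combination (G k) * h k)
    h1 (Val.const 1 z) (h3.mul hg) (h4.mul hg)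
  have h0 : c1 * (w - 1) = 0 := by linarith
  rcases mul_eq_zero.1 h0 with h | h
  · exact absurd h hc
  · linarith
end abstract_eq

noncomputable abbrev A1 (p s t M N : ℕ) := Q s ((N+1)*s) (fun j => s + j*p) (fun j => s + (t+j)*p) M
noncomputable abbrev A2 (p s t M N : ℕ) := Q (t*p+s) (t*p+(N+1)*s) (fun j => j*p) (fun j => (t+j)*p) M
noncomputable abbrev A3 (p s q M N : ℕ) :=
  Q (s+(q+1)*p) (s+(M+(q+1))*p) (fun j => j*s) (fun j => (j+1)*s+q*p) N
noncomputable abbrev A4 (p s t M N : ℕ) := Q p ((M+1)*p) (fun j => p + j*s) (fun j => (j+1)*s+t*p) N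

lemma A1_eq (p s t M N k : ℕ) : R1 s N k * P1 p s (t*p) M k = A1 p s t M N k := by
  unfold R1 P1 A1 Q lin
  push_cast
  congr 1
  · congr 1 <;> ring
  · refine Finset.prod_congr rfl fun j _ => ?_
    congr 1 <;> ring

lemma A2_eq (p s t M N k : ℕ) : R2 s (t*p) N k * P2 p (t*p) M k = A2 p s t M N k := by
  unfold R2 P2 A2 Q lin
  push_cast
  congr 1
  · congr 1 <;> ring
  · refine Finset.prod_congr rfl fun j _ => ?_
    congr 1 <;> ring

lemma A3_eq (p s q M N k : ℕ) : R3 p (s+q*p) M k * P3 s (s+q*p) N k = A3 p s q M N k := by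
  unfold R3 P3 A3 Q lin
  push_cast
  congr 1
  · congr 1 <;> ring
  · refine Finset.prod_congr rfl fun j _ => ?_
    congr 1 <;> ring

lemma A4_eq (p s q M N k : ℕ) : R4 p M k * P4 p s (s+q*p) N k = A4 p s (q+1) M N k := by
  unfold R4 P4 A4 Q lin
  push_cast
  congr 1
  · congr 1 <;> ring
  · refine Finset.prod_congr rfl fun j _ => ?_
    congr 1 <;> ring

lemma case_lt (p s q M N : ℕ) (hp : 0 < p) (hM : 0 < M) (hN : 0 < N) (hps : p < s) (hq : 1 ≤ q)
    (hMt : M < q + 1) (c1 c2 : ℝ) (hc1 : c1 ≠ 0) (hc2 : c2 ≠ 0)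
    (h : ∀ k, c1 * (A1 p s (q+1) M N k - A2 p s (q+1) M N k) =
      c2 * (A3 p s q M N k - A4 p s (q+1) M N k)) : False := by
  have hNs : s ≤ N * s := by nlinarith
  have hMp : p ≤ M * p := by nlinarith
  have hMq : M * p ≤ q * p := Nat.mul_le_mul_right p (by omega)
  have hqp : p ≤ q * p := by nlinarith
  have js : ∀ j, 1 ≤ j → s ≤ j * s := fun j hj => by nlinarith
  have jp : ∀ j, 1 ≤ j → p ≤ j * p := fun j hj => by nlinarith
  have jM : ∀ j, j ≤ M → j * p ≤ M * p := fun j hj => Nat.mul_le_mul_right p hj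
  -- regularity at `(t+1)p`
  have r3 : ∀ z, z ≤ (q+1+1)*p → Reg (A3 p s q M N) z := fun z hz =>
    ⟨_, Q_val _ _ _ _ _ _ (fun e => by linarith) (fun j h1 h2 e => by
      have := js j h1; linarith)⟩
  have r4 : Reg (A4 p s (q+1) M N) ((q+1+1)*p) :=
    ⟨_, Q_val _ _ _ _ _ _ (fun e => by linarith) (fun j h1 h2 e => by
      have := js j h1; linarith)⟩
  have g2 : Val (Q ((q+1)*p+(N+1)*s) ((q+1)*p+s) (fun j => (q+1+j)*p) (fun j => j*p) M)
      ((q+1+1)*p) 0 := by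
    rw [← qv_zero_mem ((q+1)*p+(N+1)*s) ((q+1)*p+s) (fun j => (q+1+j)*p) (fun j => j*p) M
      ((q+1+1)*p) 1 le_rfl hM rfl]
    exact Q_val _ _ _ _ _ _ (fun e => by linarith) (fun j h1 h2 e => by
      have := jM j h2; linarith)
  have hz : (N+1)*s = (q+1+1)*p := by
    by_contra hne
    apply hc1
    refine pole2 h (z := (q+1+1)*p) (fun k => Q_inv _ _ _ _ _ k) ?_ (r3 _ le_rfl) r4 g2
    exact ⟨_, Q_val _ _ _ _ _ _ (fun e => hne e.symm) (fun j h1 h2 e => by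
      have := jp j h1; linarith)⟩
  have hMN : M * p ≤ N * s := by
    by_contra hne
    apply hc2
    have hi : ∀ i, i ≤ N → i * s ≤ N * s := fun i hi => Nat.mul_le_mul_right s hi
    refine pole4 h (z := (M+1)*p) (G := Q ((M+1)*p) p (fun j => (j+1)*s+(q+1)*p)
      (fun j => p + j*s) N) (fun k => Q_inv _ _ _ _ _ k) ?_ ?_ (r3 _ (by linarith)) ?_
    · exact ⟨_, Q_val _ _ _ _ _ _ (fun e => by linarith) (fun j h1 h2 e => by
        have := jp j h1; linarith)⟩
    · exact ⟨_, Q_val _ _ _ _ _ _ (fun e => by linarith) (fun j h1 h2 e => by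
        have := jp j h1; linarith)⟩
    · rw [← qv_zero_left ((M+1)*p) p (fun j => (j+1)*s+(q+1)*p)
        (fun j => p + j*s) N ((M+1)*p) rfl]
      exact Q_val _ _ _ _ _ _ (fun e => by linarith) (fun j h1 h2 e => by
        have := hi j h2; linarith)
  -- the quotient
  have hquot := ((Q_val s ((q+1)*p+s) (fun j => s+j*p) (fun j => j*p) M ((q+1+1)*p)
    (fun e => by linarith) (fun j h1 h2 e => by have := jM j h2; linarith)).mul
    (Val.div_lin ((q+1)*p+(N+1)*s) (s+(q+1+1)*p) ((q+1+1)*p) (fun e => by linarith))).mul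
    (Val.prod ((Finset.Icc 1 M).erase 1) (z := (q+1+1)*p)
      (F := fun j k => lin ((q+1+j)*p) k / lin (s+(q+1+j)*p) k)
      (v := fun j => ((((q+1+j)*p : ℕ) : ℝ) - ((q+1+1)*p : ℕ)) /
        (((s+(q+1+j)*p : ℕ) : ℝ) - ((q+1+1)*p : ℕ)))
      (fun j hj => Val.div_lin _ _ _ (fun e => by
        rw [Finset.mem_erase, Finset.mem_Icc] at hj
        have := jp j hj.2.1; linarith)))
  have hfun : (fun k => A1 p s (q+1) M N k *
      Q ((q+1)*p+(N+1)*s) ((q+1)*p+s) (fun j => (q+1+j)*p) (fun j => j*p) M k) =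
      (fun k => Q s ((q+1)*p+s) (fun j => s+j*p) (fun j => j*p) M k *
        (lin ((q+1)*p+(N+1)*s) k / lin (s+(q+1+1)*p) k) *
        ∏ j ∈ (Finset.Icc 1 M).erase 1, (lin ((q+1+j)*p) k / lin (s+(q+1+j)*p) k)) := by
    funext k
    have e1 : (∏ j ∈ Finset.Icc 1 M, (lin (s+j*p) k / lin (s+(q+1+j)*p) k)) *
        (∏ j ∈ Finset.Icc 1 M, (lin ((q+1+j)*p) k / lin (j*p) k)) =
        (∏ j ∈ Finset.Icc 1 M, (lin (s+j*p) k / lin (j*p) k)) *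
        (lin ((q+1+1)*p) k / lin (s+(q+1+1)*p) k *
        ∏ j ∈ (Finset.Icc 1 M).erase 1, (lin ((q+1+j)*p) k / lin (s+(q+1+j)*p) k)) := by
      rw [Finset.mul_prod_erase _ (fun j => lin ((q+1+j)*p) k / lin (s+(q+1+j)*p) k)
        (by simp; omega : 1 ∈ Finset.Icc 1 M), ← Finset.prod_mul_distrib,
        ← Finset.prod_mul_distrib]
      refine Finset.prod_congr rfl fun j _ => ?_
      rw [div_mul_div_comm, div_mul_div_comm, mul_comm (lin (j*p) k)]
    have l1 := lin_ne ((q+1+1)*p) k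
    have l2 := lin_ne (s+(q+1+1)*p) k
    have l3 := lin_ne ((q+1)*p+s) k
    unfold A1 Q
    rw [mul_mul_mul_comm, e1, hz]
    field_simp
  rw [← hfun] at hquot
  have hw := pole12 h (fun k => Q_inv _ _ _ _ _ k) hquot (r3 _ le_rfl) r4 g2 hc1
  have hpR : (0:ℝ) < p := by exact_mod_cast hp
  have hpsR : (p:ℝ) < s := by exact_mod_cast hps
  have hzR : ((N:ℝ)+1)*s = (q+1+1)*p := by exact_mod_cast hz
  have hMNR : (M:ℝ) * p ≤ N * s := by exact_mod_cast hMN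
  have hMqR : (M:ℝ) * p ≤ q * p := by exact_mod_cast hMq
  have hNsR : (s:ℝ) ≤ N * s := by exact_mod_cast hNs
  have hqpR : (p:ℝ) ≤ q * p := by exact_mod_cast hqp
  have n1 : qv s ((q+1)*p+s) (fun j => s+j*p) (fun j => j*p) M ((q+1+1)*p) ≤ 0 := by
    unfold qv
    push_cast
    refine mul_nonpos_of_nonpos_of_nonneg ?_ (Finset.prod_nonneg fun j hj => ?_)
    · exact div_nonpos_of_nonpos_of_nonneg (by linarith) (by linarith)
    · rw [Finset.mem_Icc] at hj
      have : (j:ℝ) * p ≤ M * p := by exact_mod_cast jM j hj.2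
      exact div_nonneg_of_nonpos (by linarith) (by linarith)
  have n2 : 0 ≤ ((((q+1)*p+(N+1)*s : ℕ) : ℝ) - ((q+1+1)*p : ℕ)) /
      (((s+(q+1+1)*p : ℕ) : ℝ) - ((q+1+1)*p : ℕ)) := by
    push_cast
    exact div_nonneg (by linarith) (by linarith)
  have n3 : 0 ≤ ∏ j ∈ (Finset.Icc 1 M).erase 1, ((((q+1+j)*p : ℕ) : ℝ) - ((q+1+1)*p : ℕ)) /
        (((s+(q+1+j)*p : ℕ) : ℝ) - ((q+1+1)*p : ℕ)) := by
    refine Finset.prod_nonneg fun j hj => ?_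
    rw [Finset.mem_erase, Finset.mem_Icc] at hj
    have : (p:ℝ) ≤ j * p := by exact_mod_cast jp j hj.2.1
    push_cast
    exact div_nonneg (by linarith) (by linarith)
  have := mul_nonpos_of_nonpos_of_nonneg (mul_nonpos_of_nonpos_of_nonneg n1 n2) n3
  linarith

set_option maxHeartbeats 4000000 in
lemma case_ge (p s q M N : ℕ) (hp : 0 < p) (hN : 0 < N) (hps : p < s) (hq : 1 ≤ q)
    (hMt : q + 1 ≤ M) (c1 c2 : ℝ) (hc1 : c1 ≠ 0) (hc2 : c2 ≠ 0)
    (h : ∀ k, c1 * (A1 p s (q+1) M N k - A2 p s (q+1) M N k) =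
      c2 * (A3 p s q M N k - A4 p s (q+1) M N k)) : False := by
  have hs1 : A1 p s (q+1) M N = Q s ((N+1)*s) (fun j => s + j*p) (fun j => s + (M+j)*p) (q+1) :=
    Q_shift s ((N+1)*s) (fun j => s + j*p) M (q+1)
  have hs2 : A2 p s (q+1) M N =
      Q ((q+1)*p+s) ((q+1)*p+(N+1)*s) (fun j => j*p) (fun j => (M+j)*p) (q+1) :=
    Q_shift ((q+1)*p+s) ((q+1)*p+(N+1)*s) (fun j => j*p) M (q+1)
  rw [hs1, hs2] at h
  clear hs1 hs2
  have hNs : s ≤ N * s := by nlinarith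
  have hqM : (q+1) * p ≤ M * p := Nat.mul_le_mul_right p (by omega)
  have hqp : p ≤ q * p := by nlinarith
  have js : ∀ j, 1 ≤ j → s ≤ j * s := fun j hj => by nlinarith
  have jp : ∀ j, 1 ≤ j → p ≤ j * p := fun j hj => by nlinarith
  have jq : ∀ j, j ≤ q + 1 → j * p ≤ (q+1) * p := fun j hj => Nat.mul_le_mul_right p hj
  have hpR : (0:ℝ) < p := by exact_mod_cast hp
  have hpsR : (p:ℝ) < s := by exact_mod_cast hps
  have hNsR : (s:ℝ) ≤ N * s := by exact_mod_cast hNs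
  have hqMR : ((q:ℝ)+1) * p ≤ M * p := by exact_mod_cast hqM
  have hqpR : (p:ℝ) ≤ q * p := by exact_mod_cast hqp
  have jsR : ∀ j : ℕ, 1 ≤ j → (s:ℝ) ≤ j * s := fun j hj => by exact_mod_cast js j hj
  have jpR : ∀ j : ℕ, 1 ≤ j → (p:ℝ) ≤ j * p := fun j hj => by exact_mod_cast jp j hj
  -- the general evaluation principle
  have ev : ∀ z : ℕ, z ≠ (N+1)*s → (∀ j, 1 ≤ j → j ≤ q+1 → z ≠ s + (M+j)*p) →
      z ≠ (q+1)*p+(N+1)*s → (∀ j, 1 ≤ j → j ≤ q+1 → z ≠ (M+j)*p) →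
      z ≠ s+(M+(q+1))*p → (∀ j, 1 ≤ j → j ≤ N → z ≠ (j+1)*s+q*p) →
      z ≠ (M+1)*p → (∀ j, 1 ≤ j → j ≤ N → z ≠ (j+1)*s+(q+1)*p) →
      c1 * (qv s ((N+1)*s) (fun j => s + j*p) (fun j => s + (M+j)*p) (q+1) z -
        qv ((q+1)*p+s) ((q+1)*p+(N+1)*s) (fun j => j*p) (fun j => (M+j)*p) (q+1) z) =
      c2 * (qv (s+(q+1)*p) (s+(M+(q+1))*p) (fun j => j*s) (fun j => (j+1)*s+q*p) N z -
        qv p ((M+1)*p) (fun j => p + j*s) (fun j => (j+1)*s+(q+1)*p) N z) := by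
    intro z a1 b1 a2 b2 a3 b3 a4 b4
    exact eq_val h (Q_val _ _ _ _ _ _ a1 b1) (Q_val _ _ _ _ _ _ a2 b2)
      (Q_val _ _ _ _ _ _ a3 b3) (Q_val _ _ _ _ _ _ a4 b4)
  -- the general pole principle for the second term at `(M+e)p`
  have pl : ∀ e : ℕ, 1 ≤ e → e ≤ q+1 → (M+e)*p ≠ (q+1)*p+s → (M+e)*p ≠ (N+1)*s →
      (∀ j, 1 ≤ j → j ≤ q+1 → (M+e)*p ≠ s + (M+j)*p) →
      (∀ j, 1 ≤ j → j ≤ N → (M+e)*p ≠ (j+1)*s+q*p) →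
      Reg (A4 p s (q+1) M N) ((M+e)*p) → False := by
    intro e e1 e2 a1 a2 a3 a4 a5
    apply hc1
    refine pole2 h (z := (M+e)*p) (fun k => Q_inv _ _ _ _ _ k) ?_ ?_ a5 ?_
    · exact ⟨_, Q_val _ _ _ _ _ _ a2 a3⟩
    · exact ⟨_, Q_val _ _ _ _ _ _ (by simpa using a3 (q+1) (by omega) le_rfl) a4⟩
    · rw [← qv_zero_mem ((q+1)*p+(N+1)*s) ((q+1)*p+s) (fun j => (M+j)*p) (fun j => j*p) (q+1)
        ((M+e)*p) e e1 e2 rfl]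
      exact Q_val _ _ _ _ _ _ a1 (fun j h1 h2 e => by
        have := jq j h2; have := jp _ e1; linarith)
  -- sign of c1 c2
  have sgn : 0 < c1 * c2 := by
    have E := ev p (fun e => by linarith) (fun j h1 h2 e => by have := jp j h1; linarith)
      (fun e => by linarith) (fun j h1 h2 e => by have := jp j h1; linarith)
      (fun e => by linarith) (fun j h1 h2 e => by have := js j h1; linarith)
      (fun e => by linarith) (fun j h1 h2 e => by have := js j h1; linarith)
    rw [qv_zero_left p _ _ _ _ _ rfl, qv_zero_mem ((q+1)*p+s) _ _ _ _ p 1 le_rfl (by omega)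
      (by ring)] at E
    have p1 : 0 < qv s ((N+1)*s) (fun j => s + j*p) (fun j => s + (M+j)*p) (q+1) p := by
      unfold qv
      push_cast
      refine mul_pos (div_pos (by linarith) (by linarith)) (Finset.prod_pos fun j hj => ?_)
      rw [Finset.mem_Icc] at hj
      have := jpR j hj.1
      exact div_pos (by linarith) (by linarith)
    have p3 : 0 < qv (s+(q+1)*p) (s+(M+(q+1))*p) (fun j => j*s) (fun j => (j+1)*s+q*p) N p := by
      unfold qv
      push_cast
      refine mul_pos (div_pos (by linarith) (by linarith)) (Finset.prod_pos fun j hj => ?_)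
      rw [Finset.mem_Icc] at hj
      have := jsR j hj.1
      exact div_pos (by linarith) (by linarith)
    rw [sub_zero, sub_zero] at E
    have h2 : 0 < c2 ^ 2 := by positivity
    have : c1 * c2 * qv s ((N+1)*s) (fun j => s + j*p) (fun j => s + (M+j)*p) (q+1) p =
      c2 ^ 2 * qv (s+(q+1)*p) (s+(M+(q+1))*p) (fun j => j*s) (fun j => (j+1)*s+q*p) N p := by
      linear_combination c2 * E
    have h3 := mul_pos h2 p3
    rw [← this] at h3
    exact pos_of_mul_pos_left h3 p1.le
  have sgn' : ∀ a b : ℝ, c1 * a = c2 * b → b < 0 → a < 0 := by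
    intro a b hab hb
    have h1 : 0 < c1 ^ 2 := by positivity
    have h2 : c1 ^ 2 * a = c1 * c2 * b := by linear_combination c1 * hab
    have h3 : c1 * c2 * b < 0 := mul_neg_of_pos_of_neg sgn hb
    by_contra h4
    have := mul_nonneg h1.le (not_lt.1 h4)
    linarith
  -- evaluation at `s`
  have S1 : s < (M+1)*p →
      qv ((q+1)*p+s) ((q+1)*p+(N+1)*s) (fun j => j*p) (fun j => (M+j)*p) (q+1) s < 0 := by
    intro hlt
    have hltR : (s:ℝ) < ((M:ℝ)+1)*p := by exact_mod_cast hlt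
    have E := ev s (fun e => by linarith) (fun j h1 h2 e => by have := jp j h1; linarith)
      (fun e => by linarith) (fun j h1 h2 e => by have := jp j h1; linarith)
      (fun e => by linarith) (fun j h1 h2 e => by have := js j h1; linarith)
      (fun e => by linarith) (fun j h1 h2 e => by have := js j h1; linarith)
    rw [qv_zero_left s _ _ _ _ _ rfl, qv_zero_mem (s+(q+1)*p) _ _ _ _ s 1 le_rfl (by omega)
      (by ring)] at E
    have p4 : qv p ((M+1)*p) (fun j => p + j*s) (fun j => (j+1)*s+(q+1)*p) N s < 0 := by
      unfold qv
      push_cast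
      refine mul_neg_of_neg_of_pos (div_neg_of_neg_of_pos (by linarith) (by linarith))
        (Finset.prod_pos fun j hj => ?_)
      rw [Finset.mem_Icc] at hj
      have := jsR j hj.1
      exact div_pos (by linarith) (by linarith)
    exact sgn' _ _ (by linarith) p4
  have S1' : s < (M+1)*p → ∀ j, 1 ≤ j → j ≤ q+1 → s ≠ j*p := by
    intro hlt j h1 h2 e
    have := S1 hlt
    rw [qv_zero_mem _ _ _ _ _ s j h1 h2 e] at this
    exact lt_irrefl _ this
  -- evaluation at `s + p`
  have S2 : s < M*p → s < (q+1)*p := by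
    intro hlt
    by_contra hge
    have hne := S1' (by linarith) (q+1) (by omega) le_rfl
    have hgt : (q+1)*p < s := by omega
    have hgtR : ((q:ℝ)+1)*p < s := by exact_mod_cast hgt
    have hltR : (s:ℝ) < (M:ℝ)*p := by exact_mod_cast hlt
    have E := ev (s+p) (fun e => by linarith) (fun j h1 h2 e => by have := jp j h1; linarith)
      (fun e => by linarith) (fun j h1 h2 e => by have := jp j h1; linarith)
      (fun e => by linarith) (fun j h1 h2 e => by have := js j h1; linarith)
      (fun e => by linarith) (fun j h1 h2 e => by have := js j h1; linarith)
    rw [qv_zero_mem s _ _ _ _ (s+p) 1 le_rfl (by omega) (by ring),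
      qv_zero_mem p _ _ _ _ (s+p) 1 le_rfl (by omega) (by ring)] at E
    have p3 : qv (s+(q+1)*p) (s+(M+(q+1))*p) (fun j => j*s) (fun j => (j+1)*s+q*p) N (s+p) < 0 := by
      unfold qv
      rw [← Finset.mul_prod_erase _ _ (by simp; omega : 1 ∈ Finset.Icc 1 N)]
      push_cast
      refine mul_neg_of_pos_of_neg (div_pos (by linarith) (by linarith))
        (mul_neg_of_neg_of_pos (div_neg_of_neg_of_pos (by linarith) (by linarith))
        (Finset.prod_pos fun j hj => ?_))
      rw [Finset.mem_erase, Finset.mem_Icc] at hj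
      have h2 : (2:ℝ) ≤ j := by exact_mod_cast (by omega : 2 ≤ j)
      have : 2 * (s:ℝ) ≤ j * s := mul_le_mul_of_nonneg_right h2 (by linarith)
      exact div_pos (by linarith) (by linarith)
    have v' := sgn' (- qv ((q+1)*p+s) ((q+1)*p+(N+1)*s) (fun j => j*p) (fun j => (M+j)*p) (q+1)
      (s+p)) _ (by linarith) p3
    have v := S1 (by linarith)
    have hpos : 0 < qv ((q+1)*p+s) ((q+1)*p+(N+1)*s) (fun j => j*p) (fun j => (M+j)*p) (q+1) s *
        qv ((q+1)*p+s) ((q+1)*p+(N+1)*s) (fun j => j*p) (fun j => (M+j)*p) (q+1) (s+p) := by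
      unfold qv
      rw [mul_mul_mul_comm, ← Finset.prod_mul_distrib]
      push_cast
      refine mul_pos (mul_pos (div_pos (by linarith) (by linarith))
        (div_pos (by linarith) (by linarith))) (Finset.prod_pos fun j hj => ?_)
      rw [Finset.mem_Icc] at hj
      have a1 := jpR j hj.1
      have a2 : (j:ℝ)*p ≤ (q+1)*p := by exact_mod_cast jq j hj.2
      exact mul_pos_of_neg_of_neg (div_neg_of_neg_of_pos (by linarith) (by linarith))
        (div_neg_of_neg_of_pos (by linarith) (by linarith))
    have := mul_neg_of_neg_of_pos v (by linarith : 0 < qv ((q+1)*p+s) ((q+1)*p+(N+1)*s)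
      (fun j => j*p) (fun j => (M+j)*p) (q+1) (s+p))
    linarith
  -- evaluation at `s + tp`
  have S4 : (∃ j, 1 ≤ j ∧ j ≤ q+1 ∧ s + (q+1)*p = (M+j)*p) ∨ (N*s = (q+1)*p) ∨
      (∃ i, 1 ≤ i ∧ i * s = q*p) := by
    by_contra hcon
    push Not at hcon
    obtain ⟨nA, nB, nC⟩ := hcon
    have E := ev (s+(q+1)*p) (fun e => nB (by linarith))
      (fun j h1 h2 e => by have := jp j h1; linarith)
      (fun e => by linarith) (fun j h1 h2 e => nA j h1 h2 e)
      (fun e => by linarith) (fun j h1 h2 e => by have := js j h1; linarith)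
      (nA 1 le_rfl (by omega)) (fun j h1 h2 e => by have := js j h1; linarith)
    rw [qv_zero_mem s _ _ _ _ (s+(q+1)*p) (q+1) (by omega) le_rfl rfl,
      qv_zero_left ((q+1)*p+s) _ _ _ _ _ (by ring), qv_zero_left (s+(q+1)*p) _ _ _ _ _ rfl] at E
    have hne : qv p ((M+1)*p) (fun j => p + j*s) (fun j => (j+1)*s+(q+1)*p) N (s+(q+1)*p) ≠ 0 := by
      refine qv_ne _ _ _ _ _ _ (fun e => by linarith) (nA 1 le_rfl (by omega))
        (fun j h1 h2 e => ?_) (fun j h1 h2 e => by have := js j h1; linarith)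
      obtain ⟨i, rfl⟩ : ∃ i, j = i + 1 := ⟨j - 1, by omega⟩
      rcases Nat.eq_zero_or_pos i with rfl | hi
      · linarith
      · exact nC i hi (by linarith)
    have : c2 * qv p ((M+1)*p) (fun j => p + j*s) (fun j => (j+1)*s+(q+1)*p) N (s+(q+1)*p) = 0 := by
      linarith
    exact (mul_ne_zero hc2 hne) this
  rcases Nat.lt_or_ge s (M*p) with hlt | hge
  swap
  · -- `s ≥ Mp`
    have hsM : s = M * p := by
      rcases S4 with ⟨j, h1, h2, e⟩ | e | ⟨i, hi, e⟩
      · have := jq j h2; linarith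
      · linarith
      · have := js i hi; linarith
    have hMq : M ≠ q + 1 := fun e => S1' (by linarith) (q+1) (by omega) le_rfl (e ▸ hsM)
    have h3M : (q+1+1)*p ≤ M*p := Nat.mul_le_mul_right p (by omega)
    refine pl 1 le_rfl (by omega) (fun e => by linarith) (fun e => by linarith)
      (fun j h1 h2 e => by have := jp j h1; linarith)
      (fun j h1 h2 e => by have := js j h1; linarith) ?_
    exact Q_reg_cancel _ _ _ _ _ _ 1 le_rfl hN (by linarith)
      (fun j h1 h2 e => by have := js j h1; linarith)
  -- `s < Mp`
  have hst := S2 hlt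
  have hnm : ∀ n, s ≠ n * p := by
    intro n e
    have hn1 : 1 ≤ n := by
      rcases Nat.eq_zero_or_pos n with rfl | h
      · linarith
      · exact h
    have hn2 : n ≤ q+1 := by
      by_contra hc
      have := Nat.mul_le_mul_right p (by omega : q+1 ≤ n)
      linarith
    exact S1' (by linarith) n hn1 hn2 e
  -- no `s` shift between multiples of `p`
  have hnm' : ∀ a b, a * p ≠ s + b * p := by
    intro a b e
    apply hnm (a - b)
    rw [Nat.sub_mul]; omega
  have D1 : ∀ n, s ∣ n * p → ¬ s ∣ (n+1) * p := by
    intro n h1 h2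
    rw [add_mul, Nat.dvd_add_right h1, one_mul] at h2
    exact absurd (Nat.le_of_dvd hp h2) (by omega)
  have D2 : ∀ n, s ∣ n * p → ¬ s ∣ (n+2) * p := by
    intro n h1 h2
    rw [add_mul, Nat.dvd_add_right h1] at h2
    obtain ⟨c, hc⟩ := h2
    have hc2 : c < 2 := by
      by_contra h3
      have : s * 2 ≤ s * c := Nat.mul_le_mul_left s (by omega)
      linarith
    interval_cases c
    · linarith
    · exact hnm 2 (by linarith)
  -- pole principle specialised
  have pl' : ∀ e : ℕ, 1 ≤ e → e ≤ q+1 → (M+e)*p ≠ (N+1)*s →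
      (∀ j, 1 ≤ j → j ≤ N → (M+e)*p ≠ (j+1)*s+q*p) →
      Reg (A4 p s (q+1) M N) ((M+e)*p) → False := by
    intro e e1 e2 a2 a4 a5
    exact pl e e1 e2 (fun h => hnm' (M+e) (q+1) (by linarith)) a2 (fun j _ _ => hnm' _ _) a4 a5
  have pl'' : ∀ e : ℕ, 2 ≤ e → e ≤ q+1 → (M+e)*p ≠ (N+1)*s →
      (∀ j, 1 ≤ j → j ≤ N → (M+e)*p ≠ (j+1)*s+q*p) →
      (∀ j, 1 ≤ j → j ≤ N → (M+e)*p ≠ (j+1)*s+(q+1)*p) → False := by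
    intro e e1 e2 a2 a4 a5
    refine pl' e (by omega) e2 a2 a4 ⟨_, Q_val _ _ _ _ _ _ ?_ a5⟩
    intro h
    have := Nat.eq_of_mul_eq_mul_right hp h
    omega
  rcases S4 with ⟨j, h1, h2, e⟩ | hB | ⟨i, hi, hC⟩
  · exact hnm' (M+j) (q+1) e.symm
  · -- case B
    have key : ∀ e, 2 ≤ e → e ≤ q+1 → ¬ s ∣ (M+e)*p → ¬ s ∣ (M+e+1)*p → False := by
      intro e e1 e2 d1 d2
      refine pl'' e e1 e2 (fun h => d1 ⟨N+1, by linarith⟩)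
        (fun j _ _ h => d2 ⟨j+1+N, by linarith⟩) (fun j _ _ h => d1 ⟨j+1+N, by linarith⟩)
    rcases Nat.lt_or_ge q 3 with hq3 | hq3
    · have hN3 : N < 3 := by
        by_contra h3
        have := Nat.mul_le_mul_right s (by omega : 3 ≤ N)
        have := Nat.mul_le_mul_right p (by omega : q + 1 ≤ 3)
        linarith
      have hN2 : N = 2 := by
        interval_cases N
        · exact absurd hB (by rw [one_mul]; exact hnm _)
        · rfl
      subst hN2
      have hq2 : q = 2 := by
        interval_cases q
        · linarith
        · rfl
      subst hq2
      have hM0 : 3 ≤ M := hMt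
      have fin : ∀ j, 1 ≤ j → j ≤ 2 → j = 1 ∨ j = 2 := by intro j _ _; omega
      by_cases hM3 : M = 3
      · subst hM3
        refine pl' 1 le_rfl (by omega) (by omega) ?_ ?_
        · intro j h1 h2
          rcases fin j h1 h2 with rfl | rfl <;> omega
        · refine Q_reg_cancel _ _ _ _ _ _ 2 (by omega) le_rfl (by omega) ?_
          intro j h1 h2
          rcases fin j h1 h2 with rfl | rfl <;> omega
      by_cases hM4 : M = 4
      · subst hM4
        refine pl'' 3 (by omega) (by omega) (by omega) ?_ ?_
        all_goals
          intro j h1 h2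
          rcases fin j h1 h2 with rfl | rfl <;> omega
      · have h5 := Nat.mul_le_mul_right p (by omega : 5 ≤ M)
        refine pl'' 2 (by omega) (by omega) (fun e => ?_) (fun j h1 h2 e => ?_)
          (fun j h1 h2 e => ?_)
        · linarith
        · rcases fin j h1 h2 with rfl | rfl <;> linarith
        · rcases fin j h1 h2 with rfl | rfl
          · linarith
          · exact hnm' (M+2) 6 (by linarith)
    · by_cases a2 : s ∣ (M+2)*p
      · exact key 3 (by omega) (by omega) (D1 _ a2) (D2 _ a2)
      by_cases a3 : s ∣ (M+3)*p
      · exact key 4 (by omega) (by omega) (D1 _ a3) (D2 _ a3)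
      · exact key 2 (by omega) (by omega) a2 a3
  · -- case C
    have key : ∀ e, 1 ≤ e → e ≤ q → ¬ s ∣ (M+e)*p → ¬ s ∣ (M+e+1)*p → False := by
      intro e e1 e2 d1 d2
      refine pl'' (e+1) (by omega) (by omega) (fun h => d2 ⟨N+1, by linarith⟩)
        (fun j _ _ h => d2 ⟨j+1+i, by linarith⟩) (fun j _ _ h => d1 ⟨j+1+i, by linarith⟩)
    have hq3 : 3 ≤ q := by
      by_contra h3
      have h4 := Nat.mul_le_mul_right p (by omega : q ≤ 2)
      have : i < 2 := by
        by_contra h5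
        have := Nat.mul_le_mul_right s (by omega : 2 ≤ i)
        linarith
      have : i = 1 := by omega
      subst this
      exact hnm q (by linarith)
    by_cases a1 : s ∣ (M+1)*p
    · exact key 2 (by omega) (by omega) (D1 _ a1) (D2 _ a1)
    by_cases a2 : s ∣ (M+2)*p
    · exact key 3 (by omega) (by omega) (D1 _ a2) (D2 _ a2)
    · exact key 1 (by omega) (by omega) a1 a2

end CaseII

/-- Case II: if `m = t·p` with `t ≥ 2`, then Equation (Prod)
fails at some `k`. -/
theorem prodEq_fails_of_multiple (p s m l M N t : ℕ)
    (hp : 0 < p) (hs : 0 < s) (hm : 0 < m) (hl : 0 < l) (hM : 0 < M) (hN : 0 < N)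
    (hps : p < s) (hml : m < l) (hsum : l + p = m + s)
    (ht : 2 ≤ t) (hmt : m = t * p) :
    ∀ c1 c2 : ℝ, c1 ≠ 0 → c2 ≠ 0 → ∃ k : ℕ, ¬ ProdEq p s m l M N c1 c2 k := by
  intro c1 c2 hc1 hc2
  by_contra hcon
  push Not at hcon
  obtain ⟨q, rfl⟩ : ∃ q, t = q + 1 := ⟨t - 1, by omega⟩
  subst hmt
  obtain rfl : l = s + q * p := by linarith
  have h : ∀ k, c1 * (CaseII.A1 p s (q+1) M N k - CaseII.A2 p s (q+1) M N k) =
      c2 * (CaseII.A3 p s q M N k - CaseII.A4 p s (q+1) M N k) := by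
    intro k
    have := hcon k
    unfold ProdEq at this
    rwa [CaseII.A1_eq, CaseII.A2_eq, CaseII.A3_eq, CaseII.A4_eq] at this
  rcases Nat.lt_or_ge M (q+1) with hlt | hge
  · exact CaseII.case_lt p s q M N hp hM hN hps (by omega) hlt c1 c2 hc1 hc2 h
  · exact CaseII.case_ge p s q M N hp hN hps (by omega) hge c1 c2 hc1 hc2 h
end

section
/- Let p, s, m, l, M, N be positive integers with p < s, m < l, l + p = m + s, and suppose m = t·p for some integer t ≥ 2 with M ≤ t. Then for any nonzero real numbers c₁, c₂ there exists a natural number k at which Equation (Prod) fails, i.e., c₁·(R₁(k)P₁(k) − R₂(k)P₂(k)) ≠ c₂·(R₃(k)P₃(k) − R₄(k)P₄(k)). -/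
open Finset

/-- The linear polynomial `X + a`. -/
noncomputable def lin (a : ℕ) : Polynomial ℝ := Polynomial.X + Polynomial.C (a : ℝ)

lemma lin_eval_neg (a b : ℕ) : (lin a).eval (-(b : ℝ)) = 0 ↔ a = b := by
  simp only [lin, Polynomial.eval_add, Polynomial.eval_X, Polynomial.eval_C]
  constructor
  · intro h
    have : (a : ℝ) = b := by linarith
    exact_mod_cast this
  · rintro rfl; ring

/-- `(X + a) ∏_{j=1}^n (X + b + j q)`. -/
noncomputable def fac (a b q n : ℕ) : Polynomial ℝ :=
  lin a * ∏ j ∈ Finset.Icc 1 n, lin (b + j * q)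

lemma fac_eval_zero (a b q n x : ℕ) : (fac a b q n).eval (-(x : ℝ)) = 0 ↔
    a = x ∨ ∃ j, 1 ≤ j ∧ j ≤ n ∧ b + j * q = x := by
  simp [fac, Polynomial.eval_prod, Finset.prod_eq_zero_iff, lin_eval_neg, and_assoc]

lemma fac_eval_pos (a b q n k : ℕ) : 0 < (fac a b q n).eval ((k : ℝ) + 1) := by
  simp only [fac, lin, Polynomial.eval_mul, Polynomial.eval_prod, Polynomial.eval_add,
    Polynomial.eval_X, Polynomial.eval_C]
  apply mul_pos
  · positivity
  · exact Finset.prod_pos fun j _ => by positivity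

lemma term_eq (a b c d q n k : ℕ) (u v : ℝ) (f : ℕ → ℝ)
    (hu : u = k + 1 + a) (hv : v = k + 1 + c)
    (hf : ∀ j, f j = ((k : ℝ) + 1 + (b + j * q : ℕ)) / (k + 1 + (d + j * q : ℕ))) :
    u / v * ∏ j ∈ Finset.Icc 1 n, f j =
      (fac a b q n).eval ((k : ℝ) + 1) / (fac c d q n).eval ((k : ℝ) + 1) := by
  simp only [fac, lin, Polynomial.eval_mul, Polynomial.eval_prod, Polynomial.eval_add,
    Polynomial.eval_X, Polynomial.eval_C, hu, hv, hf, Finset.prod_div_distrib]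
  rw [div_mul_div_comm]

lemma poly_identity (p s m l M N : ℕ) (c1 c2 : ℝ)
    (h : ∀ k, ProdEq p s m l M N c1 c2 k) (x : ℝ) :
    c1 * ((fac s s p M).eval x * (fac (m + (N + 1) * s) m p M).eval x
        - (fac (m + s) 0 p M).eval x * (fac ((N + 1) * s) (s + m) p M).eval x)
      * ((fac (l + (M + 1) * p) l s N).eval x * (fac ((M + 1) * p) (l + p) s N).eval x) =
    c2 * ((fac (l + p) 0 s N).eval x * (fac ((M + 1) * p) (l + p) s N).eval x
        - (fac p p s N).eval x * (fac (l + (M + 1) * p) l s N).eval x)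
      * ((fac ((N + 1) * s) (s + m) p M).eval x * (fac (m + (N + 1) * s) m p M).eval x) := by
  have key : (Polynomial.C c1 * (fac s s p M * fac (m + (N + 1) * s) m p M
        - fac (m + s) 0 p M * fac ((N + 1) * s) (s + m) p M)
      * (fac (l + (M + 1) * p) l s N * fac ((M + 1) * p) (l + p) s N)) =
    (Polynomial.C c2 * (fac (l + p) 0 s N * fac ((M + 1) * p) (l + p) s N
        - fac p p s N * fac (l + (M + 1) * p) l s N)
      * (fac ((N + 1) * s) (s + m) p M * fac (m + (N + 1) * s) m p M)) := by
    apply Polynomial.eq_of_infinite_eval_eq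
    apply Set.Infinite.mono (s := Set.range fun k : ℕ => (k : ℝ) + 1)
    · rintro _ ⟨k, rfl⟩
      have hk := h k
      unfold ProdEq at hk
      have e1 : R1 s N k * P1 p s m M k = _ :=
        term_eq s s ((N + 1) * s) (s + m) p M k _ _ _ (by ring) (by push_cast; ring)
          (fun j => by push_cast; congr 1 <;> ring)
      have e2 : R2 s m N k * P2 p m M k = _ :=
        term_eq (m + s) 0 (m + (N + 1) * s) m p M k _ _ _ (by push_cast; ring) (by push_cast; ring)
          (fun j => by push_cast; congr 1 <;> ring)
      have e3 : R3 p l M k * P3 s l N k = _ :=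
        term_eq (l + p) 0 (l + (M + 1) * p) l s N k _ _ _ (by push_cast; ring) (by push_cast; ring)
          (fun j => by push_cast; congr 1 <;> ring)
      have e4 : R4 p M k * P4 p s l N k = _ :=
        term_eq p p ((M + 1) * p) (l + p) s N k _ _ _ (by ring) (by push_cast; ring)
          (fun j => by push_cast; congr 1 <;> ring)
      rw [e1, e2, e3, e4] at hk
      have b1 := (fac_eval_pos ((N + 1) * s) (s + m) p M k).ne'
      have b2 := (fac_eval_pos (m + (N + 1) * s) m p M k).ne'
      have b3 := (fac_eval_pos (l + (M + 1) * p) l s N k).ne'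
      have b4 := (fac_eval_pos ((M + 1) * p) (l + p) s N k).ne'
      rw [div_sub_div _ _ b1 b2, div_sub_div _ _ b3 b4, mul_div_assoc', mul_div_assoc',
        div_eq_div_iff (mul_ne_zero b1 b2) (mul_ne_zero b3 b4)] at hk
      simp only [Set.mem_ofPred_eq, Polynomial.eval_mul, Polynomial.eval_sub, Polynomial.eval_C]
      linear_combination hk
    · apply Set.infinite_range_of_injective
      intro a b hab
      simpa using hab
  simpa only [Polynomial.eval_mul, Polynomial.eval_sub, Polynomial.eval_C] using
    congrArg (Polynomial.eval x) key

/-- Case II, first subcase `M ≤ t`: if `m = t·p` with `t ≥ 2` and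
`M ≤ t`, then Equation (Prod) fails at some `k`. -/
theorem prodEq_fails_of_multiple_of_M_le (p s m l M N t : ℕ)
    (hp : 0 < p) (hs : 0 < s) (hm : 0 < m) (hl : 0 < l) (hM : 0 < M) (hN : 0 < N)
    (hps : p < s) (hml : m < l) (hsum : l + p = m + s)
    (ht : 2 ≤ t) (hmt : m = t * p) (hMt : M ≤ t) :
    ∀ c1 c2 : ℝ, c1 ≠ 0 → c2 ≠ 0 → ∃ k : ℕ, ¬ ProdEq p s m l M N c1 c2 k := by
  intro c1 c2 hc1 hc2
  by_contra! hcon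
  have id := poly_identity p s m l M N c1 c2 hcon
  have hNs : s ≤ N * s := Nat.le_mul_of_pos_left s hN
  have hMp : p ≤ M * p := Nat.le_mul_of_pos_left p hM
  have hMm : M * p ≤ m := hmt ▸ Nat.mul_le_mul_right p hMt
  have hjp : ∀ j, 1 ≤ j → p ≤ j * p := fun j hj => Nat.le_mul_of_pos_left p hj
  have hjs : ∀ j, 1 ≤ j → s ≤ j * s := fun j hj => Nat.le_mul_of_pos_left s hj
  have hjM : ∀ j, j ≤ M → j * p ≤ M * p := fun j hj => Nat.mul_le_mul_right p hj
  have h2p : 2 * p ≤ m := hmt ▸ Nat.mul_le_mul_right p ht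
  have eN : (N + 1) * s = N * s + s := by ring
  have eM : (M + 1) * p = M * p + p := by ring
  rcases Nat.lt_or_ge 1 M with hM2 | hM1
  · have hM2p : 2 * p ≤ M * p := Nat.mul_le_mul_right p hM2
    by_cases hdiv : ∃ j, 1 ≤ j ∧ j ≤ M ∧ 0 + j * p = s
    · -- evaluate at the common zero `-s`
      have hsM : s ≤ M * p := by
        obtain ⟨j, _, h2, h3⟩ := hdiv
        have := hjM j h2
        omega
      have h := id (-(s : ℝ))
      have a1 := (fac_eval_zero s s p M s).2 (Or.inl rfl)
      have a2 := (fac_eval_zero (m + s) 0 p M s).2 (Or.inr hdiv)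
      have a3 := (fac_eval_zero (l + p) 0 s N s).2 (Or.inr ⟨1, le_rfl, hN, by ring⟩)
      have a4 : (fac p p s N).eval (-(s : ℝ)) ≠ 0 := by
        rw [Ne, fac_eval_zero]
        rintro (h | ⟨j, j1, j2, h⟩)
        · omega
        · have := hjs j j1; omega
      have b1 : (fac ((N + 1) * s) (s + m) p M).eval (-(s : ℝ)) ≠ 0 := by
        rw [Ne, fac_eval_zero]
        rintro (h | ⟨j, j1, j2, h⟩)
        · omega
        · omega
      have b2 : (fac (m + (N + 1) * s) m p M).eval (-(s : ℝ)) ≠ 0 := by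
        rw [Ne, fac_eval_zero]
        rintro (h | ⟨j, j1, j2, h⟩)
        · omega
        · have := hjp j j1; omega
      have b3 : (fac (l + (M + 1) * p) l s N).eval (-(s : ℝ)) ≠ 0 := by
        rw [Ne, fac_eval_zero]
        rintro (h | ⟨j, j1, j2, h⟩)
        · omega
        · have := hjs j j1; omega
      rw [a1, a2, a3] at h
      have : c2 * ((fac p p s N).eval (-(s : ℝ)) * (fac (l + (M + 1) * p) l s N).eval (-(s : ℝ)))
        * ((fac ((N + 1) * s) (s + m) p M).eval (-(s : ℝ))
          * (fac (m + (N + 1) * s) m p M).eval (-(s : ℝ))) = 0 := by linear_combination h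
      simp [hc2, a4, b1, b2, b3] at this
    · -- pole of `R₁P₁` at `-(m+s+p)`
      push Not at hdiv
      have h := id (-((m + s + p : ℕ) : ℝ))
      have a1 : (fac s s p M).eval (-((m + s + p : ℕ) : ℝ)) ≠ 0 := by
        rw [Ne, fac_eval_zero]
        rintro (h | ⟨j, j1, j2, h⟩)
        · omega
        · have := hjM j j2; omega
      have b1 := (fac_eval_zero ((N + 1) * s) (s + m) p M (m + s + p)).2
        (Or.inr ⟨1, le_rfl, hM, by ring⟩)
      have b2 : (fac (m + (N + 1) * s) m p M).eval (-((m + s + p : ℕ) : ℝ)) ≠ 0 := by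
        rw [Ne, fac_eval_zero]
        rintro (h | ⟨j, j1, j2, h⟩)
        · omega
        · obtain ⟨i, rfl⟩ : ∃ i, j = i + 1 := ⟨j - 1, by omega⟩
          have e : (i + 1) * p = i * p + p := by ring
          rcases Nat.eq_zero_or_pos i with rfl | hi
          · omega
          · exact hdiv i hi (by omega) (by omega)
      have b3 : (fac (l + (M + 1) * p) l s N).eval (-((m + s + p : ℕ) : ℝ)) ≠ 0 := by
        rw [Ne, fac_eval_zero]
        rintro (h | ⟨j, j1, j2, h⟩)
        · omega
        · have hs2 := hdiv 2 (by omega) hM2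
          rcases Nat.lt_or_ge 1 j with hj | hj
          · have : 2 * s ≤ j * s := Nat.mul_le_mul_right s hj
            omega
          · obtain rfl : j = 1 := by omega
            omega
      have b4 : (fac ((M + 1) * p) (l + p) s N).eval (-((m + s + p : ℕ) : ℝ)) ≠ 0 := by
        rw [Ne, fac_eval_zero]
        rintro (h | ⟨j, j1, j2, h⟩)
        · omega
        · have := hjs j j1; omega
      rw [b1] at h
      simp [hc1, a1, b2, b3, b4, -Nat.cast_add] at h
  · -- `M = 1`: pole of `R₄P₄` at `-2p`
    obtain rfl : M = 1 := by omega
    have h := id (-((2 * p : ℕ) : ℝ))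
    have b4 := (fac_eval_zero ((1 + 1) * p) (l + p) s N (2 * p)).2 (Or.inl (by ring))
    have a4 : (fac p p s N).eval (-((2 * p : ℕ) : ℝ)) ≠ 0 := by
      rw [Ne, fac_eval_zero]
      rintro (h | ⟨j, j1, j2, h⟩)
      · omega
      · have := hjs j j1; omega
    have b1 : (fac ((N + 1) * s) (s + m) p 1).eval (-((2 * p : ℕ) : ℝ)) ≠ 0 := by
      rw [Ne, fac_eval_zero]
      rintro (h | ⟨j, j1, j2, h⟩) <;> omega
    have b2 : (fac (m + (N + 1) * s) m p 1).eval (-((2 * p : ℕ) : ℝ)) ≠ 0 := by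
      rw [Ne, fac_eval_zero]
      rintro (h | ⟨j, j1, j2, h⟩)
      · omega
      · have := hjp j j1; omega
    have b3 : (fac (l + (1 + 1) * p) l s N).eval (-((2 * p : ℕ) : ℝ)) ≠ 0 := by
      rw [Ne, fac_eval_zero]
      rintro (h | ⟨j, j1, j2, h⟩) <;> omega
    rw [b4] at h
    simp only [mul_zero, zero_sub] at h
    have h' := h.symm
    simp only [mul_eq_zero, neg_eq_zero, hc2, a4, b1, b2, b3, or_self] at h'
end

section
/- Let p, s, m, l, M, N be positive integers with p < s, m < l, l + p = m + s, and suppose m = t·p for some integer t with 2 ≤ t < M. Let c₁, c₂ be nonzero real numbers. If Equation (Prod) holds at every natural number k, then N ≥ t − 1. -/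
open Finset

/-- `(x+a) ∏_{j=1}^n (x+b+jc)`. -/
noncomputable def pf (a b c n : ℕ) (x : ℝ) : ℝ :=
  (x + a) * ∏ j ∈ Finset.Icc 1 n, (x + b + j * c)

lemma pf_poly (a b c n : ℕ) : ∃ q : Polynomial ℝ, ∀ x, q.eval x = pf a b c n x := by
  refine ⟨(Polynomial.X + Polynomial.C (a : ℝ)) *
    ∏ j ∈ Finset.Icc 1 n, (Polynomial.X + Polynomial.C (b : ℝ) + Polynomial.C ((j : ℝ) * c)), ?_⟩
  intro x
  simp [pf, Polynomial.eval_prod]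

lemma pf_pos (a b c n : ℕ) (x : ℝ) (hx : 0 < x) : 0 < pf a b c n x := by
  unfold pf
  apply mul_pos (by positivity)
  apply Finset.prod_pos
  intros
  positivity

lemma pf_zero (a b c n i : ℕ) :
    pf a b c n (-(i : ℝ)) = 0 ↔ i = a ∨ ∃ j ∈ Finset.Icc 1 n, i = b + j * c := by
  unfold pf
  rw [mul_eq_zero, Finset.prod_eq_zero_iff]
  apply or_congr
  · constructor
    · intro h
      have : (i : ℝ) = a := by linarith
      exact_mod_cast this
    · rintro rfl
      simp
  · apply exists_congr
    intro j
    apply and_congr_right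
    intro _
    constructor
    · intro h
      have : (i : ℝ) = b + j * c := by linarith
      exact_mod_cast this
    · rintro rfl
      push_cast
      ring

lemma prod_split (f : ℕ → ℝ) (M t : ℕ) :
    ∏ j ∈ Finset.Icc 1 (M + t), f j =
      (∏ j ∈ Finset.Icc 1 M, f j) * ∏ j ∈ Finset.Icc 1 t, f (M + j) := by
  induction t with
  | zero => simp
  | succ t ih =>
    rw [← add_assoc, Finset.prod_Icc_succ_top (by omega), ih,
      Finset.prod_Icc_succ_top (by omega), mul_assoc, add_assoc]

lemma prod_tele (f : ℕ → ℝ) (M t : ℕ) (hf : ∀ j, f j ≠ 0) :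
    ∏ j ∈ Finset.Icc 1 M, (f j / f (t + j)) =
      (∏ j ∈ Finset.Icc 1 t, f j) / ∏ j ∈ Finset.Icc 1 t, f (M + j) := by
  rw [Finset.prod_div_distrib, div_eq_div_iff
    (Finset.prod_ne_zero_iff.2 fun j _ => hf _) (Finset.prod_ne_zero_iff.2 fun j _ => hf _),
    ← prod_split, ← prod_split, add_comm]

lemma key (p s m l M N t : ℕ) (hmt : m = t * p) (c1 c2 : ℝ)
    (hProd : ∀ k : ℕ, ProdEq p s m l M N c1 c2 k) (x : ℝ) :
    c1 * (pf s s p t x * pf (m + (N + 1) * s) (M * p) p t x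
        - pf (m + s) 0 p t x * pf ((N + 1) * s) (s + M * p) p t x)
      * (pf (l + (M + 1) * p) l s N x * pf ((M + 1) * p) (l + p) s N x)
    = c2 * (pf (l + p) 0 s N x * pf ((M + 1) * p) (l + p) s N x
        - pf p p s N x * pf (l + (M + 1) * p) l s N x)
      * (pf ((N + 1) * s) (s + M * p) p t x * pf (m + (N + 1) * s) (M * p) p t x) := by
  have hnat : ∀ k : ℕ, ∀ x : ℝ, x = k + 1 →
    c1 * (pf s s p t x * pf (m + (N + 1) * s) (M * p) p t x
        - pf (m + s) 0 p t x * pf ((N + 1) * s) (s + M * p) p t x)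
      * (pf (l + (M + 1) * p) l s N x * pf ((M + 1) * p) (l + p) s N x)
    = c2 * (pf (l + p) 0 s N x * pf ((M + 1) * p) (l + p) s N x
        - pf p p s N x * pf (l + (M + 1) * p) l s N x)
      * (pf ((N + 1) * s) (s + M * p) p t x * pf (m + (N + 1) * s) (M * p) p t x) := by
    intro k x hx
    have hx0 : 0 < x := by rw [hx]; positivity
    have h := hProd k
    unfold ProdEq at h
    have e1 : R1 s N k * P1 p s m M k
        = pf s s p t x / pf ((N + 1) * s) (s + M * p) p t x := by
      have := prod_tele (fun j => x + s + j * p) M t (fun j => by positivity)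
      have h2 : P1 p s m M k = ∏ j ∈ Finset.Icc 1 M,
          ((fun j : ℕ => x + s + j * p) j / (fun j : ℕ => x + s + j * p) (t + j)) := by
        unfold P1
        apply Finset.prod_congr rfl
        intro j _
        simp only [hx, hmt]
        push_cast
        congr 1 <;> ring
      rw [h2, this, R1, div_mul_div_comm]
      unfold pf
      congr 1
      · rw [hx]; ring
      · congr 1
        · rw [hx]; push_cast; ring
        · apply Finset.prod_congr rfl
          intro j _
          push_cast; ring
    have e2 : R2 s m N k * P2 p m M k
        = pf (m + s) 0 p t x / pf (m + (N + 1) * s) (M * p) p t x := by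
      have := prod_tele (fun j => x + j * p) M t (fun j => by positivity)
      have h2 : P2 p m M k = ∏ j ∈ Finset.Icc 1 M,
          ((fun j : ℕ => x + j * p) j / (fun j : ℕ => x + j * p) (t + j)) := by
        unfold P2
        apply Finset.prod_congr rfl
        intro j _
        simp only [hx, hmt]
        push_cast
        congr 1 <;> ring
      rw [h2, this, R2, div_mul_div_comm]
      unfold pf
      congr 1
      · congr 1
        · rw [hx]; push_cast; ring
        · simp
      · congr 1
        · rw [hx]; push_cast; ring
        · apply Finset.prod_congr rfl
          intro j _
          push_cast; ring
    have e3 : R3 p l M k * P3 s l N k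
        = pf (l + p) 0 s N x / pf (l + (M + 1) * p) l s N x := by
      unfold R3 P3 pf
      rw [Finset.prod_div_distrib, div_mul_div_comm]
      congr 1
      all_goals
        congr 1
        · rw [hx]; push_cast; ring
        · apply Finset.prod_congr rfl
          intro j _
          rw [hx]; push_cast; ring
    have e4 : R4 p M k * P4 p s l N k
        = pf p p s N x / pf ((M + 1) * p) (l + p) s N x := by
      unfold R4 P4 pf
      rw [Finset.prod_div_distrib, div_mul_div_comm]
      congr 1
      all_goals
        congr 1
        · rw [hx]; push_cast; ring
        · apply Finset.prod_congr rfl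
          intro j _
          rw [hx]; push_cast; ring
    rw [e1, e2, e3, e4] at h
    have d1 := (pf_pos ((N + 1) * s) (s + M * p) p t x hx0).ne'
    have d2 := (pf_pos (m + (N + 1) * s) (M * p) p t x hx0).ne'
    have d3 := (pf_pos (l + (M + 1) * p) l s N x hx0).ne'
    have d4 := (pf_pos ((M + 1) * p) (l + p) s N x hx0).ne'
    rw [div_sub_div _ _ d1 d2, div_sub_div _ _ d3 d4, ← mul_div_assoc, ← mul_div_assoc,
      div_eq_div_iff (mul_ne_zero d1 d2) (mul_ne_zero d3 d4)] at h
    linear_combination h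
  obtain ⟨n1, h1⟩ := pf_poly s s p t
  obtain ⟨d1, g1⟩ := pf_poly ((N + 1) * s) (s + M * p) p t
  obtain ⟨n2, h2⟩ := pf_poly (m + s) 0 p t
  obtain ⟨d2, g2⟩ := pf_poly (m + (N + 1) * s) (M * p) p t
  obtain ⟨n3, h3⟩ := pf_poly (l + p) 0 s N
  obtain ⟨d3, g3⟩ := pf_poly (l + (M + 1) * p) l s N
  obtain ⟨n4, h4⟩ := pf_poly p p s N
  obtain ⟨d4, g4⟩ := pf_poly ((M + 1) * p) (l + p) s N
  have hq : Polynomial.C c1 * (n1 * d2 - n2 * d1) * (d3 * d4)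
      = Polynomial.C c2 * (n3 * d4 - n4 * d3) * (d1 * d2) := by
    apply Polynomial.eq_of_infinite_eval_eq
    apply Set.Infinite.mono (s := Set.range fun k : ℕ => (k : ℝ) + 1)
    · rintro _ ⟨k, rfl⟩
      simp only [Set.mem_ofPred_eq, Polynomial.eval_mul, Polynomial.eval_sub, Polynomial.eval_C,
        h1, h2, h3, h4, g1, g2, g3, g4]
      exact hnat k _ rfl
    · apply Set.infinite_range_of_injective
      intro a b hab
      simpa using hab
  have := congrArg (Polynomial.eval x) hq
  simpa only [Polynomial.eval_mul, Polynomial.eval_sub, Polynomial.eval_C,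
        h1, h2, h3, h4, g1, g2, g3, g4] using this

/-- pole counting in the subcase `M > t` of Case II: if
Equation (Prod) holds at every `k`, then `N ≥ t - 1`. -/
theorem pole_count_N_ge (p s m l M N t : ℕ)
    (hp : 0 < p) (hs : 0 < s) (hm : 0 < m) (hl : 0 < l) (hM : 0 < M) (hN : 0 < N)
    (hps : p < s) (hml : m < l) (hsum : l + p = m + s)
    (ht : 2 ≤ t) (htM : t < M) (hmt : m = t * p)
    (c1 c2 : ℝ) (hc1 : c1 ≠ 0) (hc2 : c2 ≠ 0)
    (hProd : ∀ k : ℕ, ProdEq p s m l M N c1 c2 k) :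
    t - 1 ≤ N := by
  have K := key p s m l M N t hmt c1 c2 hProd
  by_contra hcon
  have hNt : N + 2 ≤ t := by omega
  -- the case `s = a p` with `a ≤ t` is impossible
  have hbig : ∀ a, s = a * p → t < a := by
    intro a ha
    by_contra hat
    have hat : a ≤ t := by omega
    have ha1 : 1 ≤ a := by
      rcases Nat.eq_zero_or_pos a with h | h
      · subst h; omega
      · exact h
    have hap : a * p ≤ t * p := Nat.mul_le_mul_right _ hat
    have htp : t * p < M * p := Nat.mul_lt_mul_of_pos_right htM hp
    have hNs : s ≤ N * s := Nat.le_mul_of_pos_left _ hN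
    have h := K (-(s : ℝ))
    have z1 : pf s s p t (-(s : ℝ)) = 0 := (pf_zero _ _ _ _ _).2 (Or.inl rfl)
    have z2 : pf (m + s) 0 p t (-(s : ℝ)) = 0 :=
      (pf_zero _ _ _ _ _).2 (Or.inr ⟨a, by simp; omega, by omega⟩)
    have z3 : pf (l + p) 0 s N (-(s : ℝ)) = 0 :=
      (pf_zero _ _ _ _ _).2 (Or.inr ⟨1, by simp; omega, by omega⟩)
    have z4 : pf p p s N (-(s : ℝ)) ≠ 0 := by
      rw [Ne, pf_zero]
      rintro (h | ⟨j, hj, h⟩)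
      · omega
      · have := Nat.mul_le_mul_right s (mem_Icc.1 hj).1
        omega
    have y1 : pf ((N + 1) * s) (s + M * p) p t (-(s : ℝ)) ≠ 0 := by
      rw [Ne, pf_zero, add_mul]
      rintro (h | ⟨j, hj, h⟩)
      · omega
      · omega
    have y2 : pf (m + (N + 1) * s) (M * p) p t (-(s : ℝ)) ≠ 0 := by
      rw [Ne, pf_zero, add_mul]
      rintro (h | ⟨j, hj, h⟩)
      · omega
      · omega
    have y3 : pf (l + (M + 1) * p) l s N (-(s : ℝ)) ≠ 0 := by
      rw [Ne, pf_zero, add_mul]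
      rintro (h | ⟨j, hj, h⟩)
      · omega
      · have := Nat.mul_le_mul_right s (mem_Icc.1 hj).1
        omega
    rw [z1, z2, z3] at h
    have h' : c2 * pf p p s N (-(s : ℝ)) * pf (l + (M + 1) * p) l s N (-(s : ℝ)) *
      pf ((N + 1) * s) (s + M * p) p t (-(s : ℝ)) *
      pf (m + (N + 1) * s) (M * p) p t (-(s : ℝ)) = 0 := by linear_combination h
    simp_all
  -- disjointness of the two families of poles
  have hdis : ∀ j ∈ Icc 1 t, ∀ j' ∈ Icc 1 t, s + M * p + j * p ≠ M * p + j' * p := by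
    intro j hj j' hj' h
    rw [mem_Icc] at hj hj'
    have h1 : s = (j' - j) * p := by rw [Nat.sub_mul]; omega
    have := hbig _ h1
    omega
  let A := (Icc 1 t).image fun j => s + M * p + j * p
  let B := (Icc 1 t).image fun j => M * p + j * p
  let C : Finset ℕ := (insert (l + (M + 1) * p) ((Icc 1 N).image fun j => l + j * s)) ∪
    (insert ((M + 1) * p) ((Icc 1 N).image fun j => l + p + j * s))
  have hCmem : ∀ i : ℕ, pf (l + (M + 1) * p) l s N (-(i : ℝ)) *
      pf ((M + 1) * p) (l + p) s N (-(i : ℝ)) = 0 → i ∈ C := by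
    intro i hi
    rw [mul_eq_zero, pf_zero, pf_zero] at hi
    simp only [C, mem_union, mem_insert, mem_image]
    rcases hi with (h | ⟨j, hj, h⟩) | (h | ⟨j, hj, h⟩)
    · exact Or.inl (Or.inl h)
    · exact Or.inl (Or.inr ⟨j, hj, h.symm⟩)
    · exact Or.inr (Or.inl h)
    · exact Or.inr (Or.inr ⟨j, hj, h.symm⟩)
  have hCcard : C.card ≤ 2 * N + 2 := by
    have e1 : ((Icc 1 N).image fun j => l + j * s).card ≤ N := by
      simpa using card_image_le (s := Icc 1 N) (f := fun j => l + j * s)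
    have e2 : ((Icc 1 N).image fun j => l + p + j * s).card ≤ N := by
      simpa using card_image_le (s := Icc 1 N) (f := fun j => l + p + j * s)
    have := card_union_le (insert (l + (M + 1) * p) ((Icc 1 N).image fun j => l + j * s))
      (insert ((M + 1) * p) ((Icc 1 N).image fun j => l + p + j * s))
    have e3 := card_insert_le (l + (M + 1) * p) ((Icc 1 N).image fun j => l + j * s)
    have e4 := card_insert_le ((M + 1) * p) ((Icc 1 N).image fun j => l + p + j * s)
    simp only [C]
    omega
  have hAC : A ⊆ C := by
    intro i hi
    obtain ⟨j, hj, rfl⟩ := mem_image.1 hi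
    by_cases hx : s + M * p + j * p = m + (N + 1) * s
    · simp only [C, mem_union, mem_insert, mem_image]
      refine Or.inr (Or.inr ⟨N, by simp; omega, ?_⟩)
      rw [hx, add_mul]; omega
    apply hCmem
    have h := K (-((s + M * p + j * p : ℕ) : ℝ))
    have z1 : pf ((N + 1) * s) (s + M * p) p t (-((s + M * p + j * p : ℕ) : ℝ)) = 0 :=
      (pf_zero _ _ _ _ _).2 (Or.inr ⟨j, hj, rfl⟩)
    have y1 : pf s s p t (-((s + M * p + j * p : ℕ) : ℝ)) ≠ 0 := by
      rw [Ne, pf_zero]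
      have : t * p < M * p := Nat.mul_lt_mul_of_pos_right htM hp
      rintro (h | ⟨j', hj', h⟩)
      · omega
      · have := Nat.mul_le_mul_right p (mem_Icc.1 hj').2
        omega
    have y2 : pf (m + (N + 1) * s) (M * p) p t (-((s + M * p + j * p : ℕ) : ℝ)) ≠ 0 := by
      rw [Ne, pf_zero]
      rintro (h | ⟨j', hj', h⟩)
      · exact hx h
      · exact hdis j hj j' hj' h
    rw [z1] at h
    have h' := h.trans (by ring : _ = (0 : ℝ))
    rw [mul_zero, sub_zero] at h'
    rcases mul_eq_zero.1 h' with h' | h'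
    · exact absurd h' (mul_ne_zero hc1 (mul_ne_zero y1 y2))
    · exact h'
  have hBC : ∀ i ∈ B, i ≠ (N + 1) * s → i ≠ m + s → i ∈ C := by
    intro i hi hx1 hx2
    obtain ⟨j, hj, rfl⟩ := mem_image.1 hi
    apply hCmem
    have h := K (-((M * p + j * p : ℕ) : ℝ))
    have z1 : pf (m + (N + 1) * s) (M * p) p t (-((M * p + j * p : ℕ) : ℝ)) = 0 :=
      (pf_zero _ _ _ _ _).2 (Or.inr ⟨j, hj, rfl⟩)
    have y1 : pf (m + s) 0 p t (-((M * p + j * p : ℕ) : ℝ)) ≠ 0 := by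
      rw [Ne, pf_zero]
      have : t * p < M * p := Nat.mul_lt_mul_of_pos_right htM hp
      rintro (h | ⟨j', hj', h⟩)
      · omega
      · have := Nat.mul_le_mul_right p (mem_Icc.1 hj').2
        omega
    have y2 : pf ((N + 1) * s) (s + M * p) p t (-((M * p + j * p : ℕ) : ℝ)) ≠ 0 := by
      rw [Ne, pf_zero]
      rintro (h | ⟨j', hj', h⟩)
      · exact hx1 h
      · exact hdis j' hj' j hj h.symm
    rw [z1] at h
    have h' := h.trans (by ring : _ = (0 : ℝ))
    rw [mul_zero, zero_sub] at h'
    rcases mul_eq_zero.1 h' with h' | h'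
    · exact absurd h' (mul_ne_zero hc1 (neg_ne_zero.2 (mul_ne_zero y1 y2)))
    · exact h'
  have hcard : (A ∪ B).card = 2 * t := by
    rw [card_union_of_disjoint]
    · have e1 : A.card = t := by
        simp only [A]
        rw [card_image_of_injective]
        · simp
        · intro x y h
          exact Nat.eq_of_mul_eq_mul_right hp (by simpa using h)
      have e2 : B.card = t := by
        simp only [B]
        rw [card_image_of_injective]
        · simp
        · intro x y h
          exact Nat.eq_of_mul_eq_mul_right hp (by simpa using h)
      omega
    · rw [disjoint_left]
      intro i hi hi'
      obtain ⟨j, hj, rfl⟩ := mem_image.1 hi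
      obtain ⟨j', hj', h⟩ := mem_image.1 hi'
      exact hdis j hj j' hj' h.symm
  -- at most one lost pole is impossible
  have hone : ∀ e, (∀ i ∈ B, i ≠ e → i ∈ C) → False := by
    intro e he
    have hsub : A ∪ B ⊆ insert e C := by
      intro i hi
      rw [mem_insert]
      by_cases hie : i = e
      · exact Or.inl hie
      · right
        rcases mem_union.1 hi with h | h
        · exact hAC h
        · exact he i h hie
    have := card_le_card hsub
    have := card_insert_le e C
    omega
  have hB1 : (N + 1) * s ∈ B := by
    by_contra hb
    exact hone (m + s) fun i hi hne => hBC i hi (fun h => hb (h ▸ hi)) hne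
  have hB2 : m + s ∈ B := by
    by_contra hb
    exact hone ((N + 1) * s) fun i hi hne => hBC i hi hne (fun h => hb (h ▸ hi))
  obtain ⟨j, hj, hj1⟩ := mem_image.1 hB1
  obtain ⟨j', hj', hj2⟩ := mem_image.1 hB2
  rw [mem_Icc] at hj hj'
  have hsa : s = (M + j' - t) * p := by
    rw [Nat.sub_mul, add_mul]; omega
  obtain ⟨a, ha⟩ : ∃ a, a = M + j' - t := ⟨_, rfl⟩
  rw [← ha] at hsa
  have hta := hbig a hsa
  have hNa : (N + 1) * a = M + j := by
    apply Nat.eq_of_mul_eq_mul_right hp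
    rw [add_mul M j p, hj1, hsa]; ring
  have hN1 : N = 1 := by
    by_contra hne
    have : 2 ≤ N := by omega
    have : 3 * a ≤ (N + 1) * a := Nat.mul_le_mul_right _ (by omega)
    omega
  subst hN1
  have ht3 : t = 3 := by
    have hsub : A ∪ B ⊆ insert ((1 + 1) * s) (insert (m + s) C) := by
      intro i hi
      rw [mem_insert, mem_insert]
      by_cases h1 : i = (1 + 1) * s
      · exact Or.inl h1
      by_cases h2 : i = m + s
      · exact Or.inr (Or.inl h2)
      right; right
      rcases mem_union.1 hi with h | h
      · exact hAC h
      · exact hBC i h h1 h2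
    have := card_le_card hsub
    have := card_insert_le ((1 + 1) * s) (insert (m + s) C)
    have := card_insert_le (m + s) C
    omega
  subst ht3
  have hA2 : s + M * p + 2 * p ∈ C := hAC (mem_image.2 ⟨2, by simp, rfl⟩)
  have hcases : (a = 4 ∧ M = 5) ∨ (a = 4 ∧ M = 6) ∨ (a = 5 ∧ M = 7) := by omega
  rcases hcases with ⟨ha', hM'⟩ | ⟨ha', hM'⟩ | ⟨ha', hM'⟩
  · have hl6 : l = 6 * p := by subst ha'; omega
    rw [ha'] at hsa
    subst hM' hsa hl6 hmt
    have hp' : (p : ℝ) ≠ 0 := by exact_mod_cast hp.ne'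
    have k4 := K (-4 * p)
    have k5 := K (-5 * p)
    have hI3 : Icc 1 3 = ({1, 2, 3} : Finset ℕ) := rfl
    simp [pf, hI3] at k4 k5
    ring_nf at k4 k5
    have h0 : c2 * (p : ℝ) ^ 12 = 0 := by linarith
    exact mul_ne_zero hc2 (pow_ne_zero 12 hp') h0
  · have hl6 : l = 6 * p := by subst ha'; omega
    rw [ha'] at hsa
    subst hM' hsa hl6
    simp [C] at hA2
    omega
  · have hl6 : l = 7 * p := by subst ha'; omega
    rw [ha'] at hsa
    subst hM' hsa hl6
    simp [C] at hA2
    omega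
end
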